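/- arXiv:2201.02776 — 2 statements merged into one kernel-verified Lean document; each statement's English description precedes it below -/
import Mathlib

section
/- Let N = N₁ ⊕ ⋯ ⊕ N_s be a finite-dimensional nilpotent complex Leibniz algebra which is a direct sum of ideals, each N_t non-split and non-abelian. Then any two finite-dimensional complex solvable Leibniz algebras whose nilradicals are isomorphic to N and whose dimension equals dim N + dim(N/N²) are isomorphic as Leibniz algebras. -/
open Module Submodule

universe u v w

/-- A bilinear bracket on `L`. -/
abbrev Bil (L : Type u) [AddCommGroup L] [Module ℂ L] : Type u := L →ₗ[ℂ] L →ₗ[ℂ] L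

variable {L : Type u} [AddCommGroup L] [Module ℂ L]

/-- The (right) Leibniz identity. -/
def IsLeibniz (br : Bil L) : Prop :=
  ∀ x y z : L, br (br x y) z = br (br x z) y + br x (br y z)

/-- The span of all brackets `[S, T]`. -/
def bspan (br : Bil L) (S T : Submodule ℂ L) : Submodule ℂ L :=
  Submodule.span ℂ {z : L | ∃ x ∈ S, ∃ y ∈ T, z = br x y}

/-- `I` is a (two-sided) ideal of the subalgebra `S`. -/
def IsIdealIn (br : Bil L) (S I : Submodule ℂ L) : Prop :=
  I ≤ S ∧ ∀ x ∈ I, ∀ y ∈ S, br x y ∈ I ∧ br y x ∈ I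

/-- `I` is a (two-sided) ideal of the whole algebra. -/
abbrev IsIdeal (br : Bil L) (I : Submodule ℂ L) : Prop := IsIdealIn br ⊤ I

/-- Lower central series of the subalgebra `S`. -/
def lcs (br : Bil L) (S : Submodule ℂ L) : ℕ → Submodule ℂ L
  | 0 => S
  | n + 1 => bspan br (lcs br S n) S

/-- The subalgebra `S` is nilpotent. -/
def IsNilpotentSub (br : Bil L) (S : Submodule ℂ L) : Prop :=
  ∃ n, lcs br S n = ⊥

/-- Derived series of the subalgebra `S`. -/
def derS (br : Bil L) (S : Submodule ℂ L) : ℕ → Submodule ℂ L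
  | 0 => S
  | n + 1 => bspan br (derS br S n) (derS br S n)

/-- The subalgebra `S` is solvable. -/
def IsSolvableSub (br : Bil L) (S : Submodule ℂ L) : Prop :=
  ∃ m, derS br S m = ⊥

/-- `N` is the nilradical (maximal nilpotent ideal) of the subalgebra `S`. -/
def IsNilradicalIn (br : Bil L) (S N : Submodule ℂ L) : Prop :=
  IsIdealIn br S N ∧ IsNilpotentSub br N ∧
    ∀ I : Submodule ℂ L, IsIdealIn br S I → IsNilpotentSub br I → I ≤ N

/-- `N` is the nilradical of the whole algebra. -/
abbrev IsNilradical (br : Bil L) (N : Submodule ℂ L) : Prop := IsNilradicalIn br ⊤ N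

/-- `N² = [N, N]`. -/
abbrev sqr (br : Bil L) (N : Submodule ℂ L) : Submodule ℂ L := bspan br N N

/-- `dim (N / N²)`. -/
noncomputable def dimModSq (br : Bil L) (N : Submodule ℂ L) : ℕ :=
  finrank ℂ (↥N ⧸ (Submodule.comap N.subtype (sqr br N)))

/-- The subalgebra `S` splits as a direct sum of two nonzero ideals. -/
def IsSplitIn (br : Bil L) (S : Submodule ℂ L) : Prop :=
  ∃ A B : Submodule ℂ L, IsIdealIn br S A ∧ IsIdealIn br S B ∧
    A ≠ ⊥ ∧ B ≠ ⊥ ∧ A ⊓ B = ⊥ ∧ A ⊔ B = S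

/-- The subalgebra `S` is abelian. -/
def IsAbelianIn (br : Bil L) (S : Submodule ℂ L) : Prop :=
  ∀ x ∈ S, ∀ y ∈ S, br x y = 0

section Two
variable {L1 : Type v} {L2 : Type w} [AddCommGroup L1] [Module ℂ L1]
  [AddCommGroup L2] [Module ℂ L2]

/-- A bracket-preserving linear isomorphism between the subalgebra `S1` of `L1` and
the subalgebra `S2` of `L2`. -/
def SubAlgIso (br1 : Bil L1) (S1 : Submodule ℂ L1) (br2 : Bil L2) (S2 : Submodule ℂ L2) :
    Prop :=
  ∃ φ : S1 →ₗ[ℂ] L2, Function.Injective φ ∧ Set.range ⇑φ = (S2 : Set L2) ∧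
    ∀ x y z : S1, (z : L1) = br1 (x : L1) (y : L1) → φ z = br2 (φ x) (φ y)

/-- An isomorphism of the two algebras. -/
def AlgIso (br1 : Bil L1) (br2 : Bil L2) : Prop :=
  ∃ φ : L1 ≃ₗ[ℂ] L2, ∀ x y : L1, φ (br1 x y) = br2 (φ x) (φ y)

end Two

/-! ### The theorem of Lie for right representations of a solvable Leibniz algebra -/

section LieThm
attribute [local instance] LieRing.ofAssociativeRing
variable {A : Type u} [AddCommGroup A] [Module ℂ A]
variable {V : Type v} [AddCommGroup V] [Module ℂ V]

/-- A right representation. -/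
def IsRightRep (br : Bil A) (ρ : A →ₗ[ℂ] Module.End ℂ V) : Prop :=
  ∀ x y, ρ (br x y) = ρ y * ρ x - ρ x * ρ y

/-- The image of a right representation as a Lie subalgebra. -/
def repRange (br : Bil A) (ρ : A →ₗ[ℂ] Module.End ℂ V) (h : IsRightRep br ρ) :
    LieSubalgebra ℂ (Module.End ℂ V) :=
  { LinearMap.range ρ with
    lie_mem' := by
      rintro X Y ⟨x, rfl⟩ ⟨y, rfl⟩
      refine ⟨br y x, ?_⟩
      rw [h, Ring.lie_def] }

theorem repRange_solvable (br : Bil A) (ρ : A →ₗ[ℂ] Module.End ℂ V) (h : IsRightRep br ρ)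
    (hs : IsSolvableSub br (⊤ : Submodule ℂ A)) :
    LieAlgebra.IsSolvable (repRange br ρ h) := by
  obtain ⟨m, hm⟩ := hs
  have key : ∀ n, ∀ X ∈ LieAlgebra.derivedSeries ℂ (repRange br ρ h) n,
      (X : Module.End ℂ V) ∈ (derS br ⊤ n).map ρ := by
    intro n
    induction n with
    | zero =>
      intro X _
      obtain ⟨x, hx⟩ := X.2
      exact ⟨x, trivial, hx⟩
    | succ n ih =>
      intro X hX
      rw [LieAlgebra.derivedSeries_def, LieAlgebra.derivedSeriesOfIdeal_succ,
        ← LieSubmodule.mem_toSubmodule, LieSubmodule.lieIdeal_oper_eq_linear_span'] at hX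
      induction hX using Submodule.span_induction with
      | mem X hX =>
        obtain ⟨P, hP, Q, hQ, rfl⟩ := hX
        obtain ⟨p, hp, hp'⟩ := ih P hP
        obtain ⟨q, hq, hq'⟩ := ih Q hQ
        refine ⟨br q p, Submodule.subset_span ⟨q, hq, p, hp, rfl⟩, ?_⟩
        rw [h, LieSubalgebra.coe_bracket, Ring.lie_def, hp', hq']
      | zero => exact Submodule.zero_mem _
      | add X Y _ _ h1 h2 => exact Submodule.add_mem _ h1 h2
      | smul c X _ h1 => exact Submodule.smul_mem _ c h1
  refine (LieAlgebra.isSolvable_iff ℂ (repRange br ρ h)).2 ⟨m, ?_⟩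
  rw [LieSubmodule.eq_bot_iff]
  intro X hX
  have := key m X hX
  rw [hm] at this
  simp at this
  exact this

theorem exists_common_eigenvector [FiniteDimensional ℂ V] [Nontrivial V]
    (br : Bil A) (ρ : A →ₗ[ℂ] Module.End ℂ V) (h : IsRightRep br ρ)
    (hs : IsSolvableSub br (⊤ : Submodule ℂ A)) :
    ∃ v : V, v ≠ 0 ∧ ∃ χ : A →ₗ[ℂ] ℂ, ∀ x, ρ x v = χ x • v := by
  have := repRange_solvable br ρ h hs
  obtain ⟨χ, hχ⟩ := LieModule.exists_nontrivial_weightSpace_of_isSolvable ℂ (repRange br ρ h) V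
  obtain ⟨⟨v, hv⟩, hv0⟩ := exists_ne (0 : LieModule.weightSpace V χ)
  let r : A →ₗ[ℂ] repRange br ρ h :=
    LinearMap.codRestrict (repRange br ρ h).toSubmodule ρ (fun x => ⟨x, rfl⟩)
  refine ⟨v, ?_, χ.comp r, ?_⟩
  · intro h0
    exact hv0 (Subtype.ext h0)
  · intro x
    rw [LieModule.mem_weightSpace] at hv
    exact hv (r x)

theorem hasEigenvalue_of_quot [FiniteDimensional ℂ V] (f : Module.End ℂ V) (p : Submodule ℂ V)
    (hp : p ≤ p.comap f) (μ : ℂ) (hμ : Module.End.HasEigenvalue (p.mapQ p f hp) μ) :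
    Module.End.HasEigenvalue f μ := by
  by_contra hf
  have hinj : Function.Injective (f - algebraMap ℂ (Module.End ℂ V) μ) := by
    rw [← LinearMap.ker_eq_bot]
    by_contra hne
    apply hf
    rw [Module.End.hasEigenvalue_iff, Module.End.eigenspace_def]
    exact hne
  have hsurj : Function.Surjective (f - algebraMap ℂ (Module.End ℂ V) μ) :=
    LinearMap.injective_iff_surjective.1 hinj
  have hs2 : Function.Surjective (p.mapQ p f hp - algebraMap ℂ (Module.End ℂ (V ⧸ p)) μ) := by
    intro y
    obtain ⟨y, rfl⟩ := p.mkQ_surjective y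
    obtain ⟨x, rfl⟩ := hsurj y
    refine ⟨p.mkQ x, ?_⟩
    simp [Module.algebraMap_end_apply]
  have hi2 := LinearMap.injective_iff_surjective.2 hs2
  obtain ⟨w, hw⟩ := hμ.exists_hasEigenvector
  apply hw.2
  apply hi2
  simp [Module.algebraMap_end_apply, hw.apply_eq_smul]

end LieThm

/-- Triangularisation. -/
theorem triangularize {A : Type u} [AddCommGroup A] [Module ℂ A] (br : Bil A)
    (hs : IsSolvableSub br (⊤ : Submodule ℂ A)) (n : ℕ) :
    ∀ (V : Type v) [AddCommGroup V] [Module ℂ V] [FiniteDimensional ℂ V], finrank ℂ V = n →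
    ∀ (ρ : A →ₗ[ℂ] Module.End ℂ V), IsRightRep br ρ →
    ∃ χ : Fin n → (A →ₗ[ℂ] ℂ), (∀ i x y, χ i (br x y) = 0) ∧
      (∀ i x, Module.End.HasEigenvalue (ρ x) (χ i x)) ∧
      (∀ zs : List A, (∀ z ∈ zs, ∀ i, χ i z = 0) → zs.length = n → (zs.map ρ).prod = 0) := by
  induction n with
  | zero =>
    intro V _ _ _ hV ρ h
    have : Subsingleton V := finrank_zero_iff.1 hV
    exact ⟨Fin.elim0, fun i => i.elim0, fun i => i.elim0, fun zs _ _ => Subsingleton.elim _ _⟩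
  | succ n ih =>
    intro V _ _ _ hV ρ h
    have : Nontrivial V := Module.nontrivial_of_finrank_pos (R := ℂ) (by omega)
    obtain ⟨v, hv, χ0, hχ0⟩ := exists_common_eigenvector br ρ h hs
    let p : Submodule ℂ V := ℂ ∙ v
    have hp : ∀ x, p ≤ p.comap (ρ x) := by
      intro x
      rw [Submodule.span_singleton_le_iff_mem]
      show ρ x v ∈ p
      rw [hχ0]
      exact Submodule.smul_mem _ _ (Submodule.mem_span_singleton_self v)
    let ρ' : A →ₗ[ℂ] Module.End ℂ (V ⧸ p) :=
      { toFun := fun x => p.mapQ p (ρ x) (hp x)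
        map_add' := by
          intro x y
          apply LinearMap.ext
          intro w
          obtain ⟨w, rfl⟩ := p.mkQ_surjective w
          simp
        map_smul' := by
          intro c y
          apply LinearMap.ext
          intro w
          obtain ⟨w, rfl⟩ := p.mkQ_surjective w
          simp }
    have hρ' : ∀ x w, ρ' x (p.mkQ w) = p.mkQ (ρ x w) := fun x w => rfl
    have h' : IsRightRep br ρ' := by
      intro x y
      apply LinearMap.ext
      intro w
      obtain ⟨w, rfl⟩ := p.mkQ_surjective w
      rw [hρ', h]
      simp only [LinearMap.sub_apply, Module.End.mul_apply, hρ', map_sub]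
    have hd : finrank ℂ (V ⧸ p) = n := by
      have h1 := Submodule.finrank_quotient_add_finrank p
      have h2 : finrank ℂ p = 1 := finrank_span_singleton hv
      omega
    obtain ⟨χ, hχ1, hχ2, hχ3⟩ := ih (V ⧸ p) hd ρ' h'
    refine ⟨Fin.cons χ0 χ, ?_, ?_, ?_⟩
    · intro i x y
      refine Fin.cases ?_ (fun i => ?_) i
      · simp only [Fin.cons_zero]
        have e1 := hχ0 (br x y)
        rw [h, LinearMap.sub_apply, Module.End.mul_apply, Module.End.mul_apply, hχ0, hχ0,
          map_smul, map_smul, hχ0, hχ0, smul_smul, smul_smul, mul_comm, sub_self] at e1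
        exact (smul_eq_zero.1 e1.symm).resolve_right hv
      · simpa only [Fin.cons_succ] using hχ1 i x y
    · intro i x
      refine Fin.cases ?_ (fun i => ?_) i
      · simp only [Fin.cons_zero]
        exact Module.End.hasEigenvalue_of_hasEigenvector
          (Module.End.hasEigenvector_iff.2 ⟨Module.End.mem_eigenspace_iff.2 (hχ0 x), hv⟩)
      · simp only [Fin.cons_succ]
        exact hasEigenvalue_of_quot (ρ x) p (hp x) _ (hχ2 i x)
    · intro zs hz hl
      obtain _ | ⟨z, zs⟩ := zs
      · simp at hl
      have h0 := hχ3 zs (fun z' hz' i => by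
        simpa using hz z' (List.mem_cons_of_mem _ hz') i.succ) (by simpa using hl)
      have hcomm : ∀ (l : List A) (w : V),
          p.mkQ ((l.map ρ).prod w) = (l.map ρ').prod (p.mkQ w) := by
        intro l
        induction l with
        | nil => intro w; simp
        | cons a l ihl =>
          intro w
          simp only [List.map_cons, List.prod_cons, Module.End.mul_apply]
          rw [← ihl, hρ']
      apply LinearMap.ext
      intro w
      have h1 := hcomm zs w
      rw [h0, LinearMap.zero_apply] at h1
      have h2 : (zs.map ρ).prod w ∈ p := by simpa using h1
      obtain ⟨c, hc⟩ := Submodule.mem_span_singleton.1 h2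
      simp only [List.map_cons, List.prod_cons, Module.End.mul_apply]
      rw [← hc, map_smul, hχ0]
      have h3 : χ0 z = 0 := by simpa using hz z (by simp) 0
      simp [h3]

/-! ### Generalities on algebras, derivations and gradings -/

section Gen
variable {V : Type u} [AddCommGroup V] [Module ℂ V]

/-- `D` is a derivation of the bracket. -/
def IsDer (br : Bil V) (D : Module.End ℂ V) : Prop :=
  ∀ x y, D (br x y) = br (D x) y + br x (D y)

/-- The family `e` generates the algebra. -/
def Generates (br : Bil V) {ι : Type} (e : ι → V) : Prop :=
  ∀ S : Submodule ℂ V, (∀ i, e i ∈ S) → (∀ x ∈ S, ∀ y ∈ S, br x y ∈ S) → S = ⊤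

/-- An algebra automorphism. -/
def IsAut (br : Bil V) (g : V ≃ₗ[ℂ] V) : Prop :=
  ∀ x y, g (br x y) = br (g x) (g y)

theorem br_mem_bspan (br : Bil V) {S T : Submodule ℂ V} {x y : V} (hx : x ∈ S) (hy : y ∈ T) :
    br x y ∈ bspan br S T := Submodule.subset_span ⟨x, hx, y, hy, rfl⟩

theorem br_mem_sqr (br : Bil V) (x y : V) : br x y ∈ sqr br (⊤ : Submodule ℂ V) :=
  br_mem_bspan br trivial trivial

theorem br_span_mem (br : Bil V) {s : Set V} {U : Submodule ℂ V} {x y : V}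
    (h : ∀ z ∈ s, br x z ∈ U) (hy : y ∈ Submodule.span ℂ s) : br x y ∈ U := by
  have : Submodule.span ℂ s ≤ U.comap (br x) := Submodule.span_le.2 h
  exact this hy

theorem lcs_mul (br : Bil V) (hL : IsLeibniz br) (b : ℕ) : ∀ a, ∀ x ∈ lcs br (⊤ : Submodule ℂ V) a,
    ∀ y ∈ lcs br (⊤ : Submodule ℂ V) b, br x y ∈ lcs br (⊤ : Submodule ℂ V) (a + b + 1) := by
  induction b with
  | zero => intro a x hx y _; exact br_mem_bspan br hx trivial
  | succ b ih =>
    intro a x hx y hy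
    refine br_span_mem br ?_ hy
    rintro _ ⟨p, hp, q, -, rfl⟩
    have e : br x (br p q) = br (br x p) q - br (br x q) p := by
      rw [hL x p q]; abel
    rw [e]
    refine Submodule.sub_mem _ ?_ ?_
    · exact br_mem_bspan br (ih a x hx p hp) trivial
    · have := ih (a + 1) (br x q) (br_mem_bspan br hx trivial) p hp
      rwa [show a + 1 + b + 1 = a + (b + 1) + 1 by ring] at this

theorem lcs_anti (br : Bil V) (n : ℕ) :
    lcs br (⊤ : Submodule ℂ V) (n + 1) ≤ lcs br (⊤ : Submodule ℂ V) n := by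
  induction n with
  | zero => exact le_top
  | succ n ih =>
    refine Submodule.span_le.2 ?_
    rintro _ ⟨x, hx, y, hy, rfl⟩
    exact br_mem_bspan br (ih hx) hy

theorem eq_top_of_sup_sqr (br : Bil V) (hL : IsLeibniz br)
    (hnil : IsNilpotentSub br (⊤ : Submodule ℂ V)) (S : Submodule ℂ V)
    (hS : ∀ x ∈ S, ∀ y ∈ S, br x y ∈ S) (h : S ⊔ sqr br ⊤ = ⊤) : S = ⊤ := by
  obtain ⟨n, hn⟩ := hnil
  have key : ∀ n, S ⊔ lcs br ⊤ n = ⊤ := by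
    intro n
    induction n with
    | zero => exact sup_top_eq S
    | succ n ih =>
      have hle : sqr br ⊤ ≤ S ⊔ lcs br ⊤ (n + 1) := by
        refine Submodule.span_le.2 ?_
        rintro _ ⟨x, hx, y, hy, rfl⟩
        rw [← ih] at hx hy
        obtain ⟨s, hs, l, hl, rfl⟩ := Submodule.mem_sup.1 hx
        obtain ⟨s', hs', l', hl', rfl⟩ := Submodule.mem_sup.1 hy
        have e : br (s + l) (s' + l') = br s s' + (br s l' + br l (s' + l')) := by
          simp only [map_add, LinearMap.add_apply]; abel
        rw [e]
        refine Submodule.add_mem_sup (hS s hs s' hs') (Submodule.add_mem _ ?_ ?_)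
        · have := lcs_mul br hL n 0 s trivial l' hl'
          rwa [zero_add] at this
        · exact br_mem_bspan br hl trivial
      have h2 : S ⊔ sqr br ⊤ ≤ S ⊔ lcs br ⊤ (n + 1) := sup_le le_sup_left hle
      rwa [h, top_le_iff] at h2
  have := key n
  rwa [hn, sup_bot_eq] at this

theorem generates_of_sup_sqr (br : Bil V) (hL : IsLeibniz br)
    (hnil : IsNilpotentSub br (⊤ : Submodule ℂ V)) {ι : Type} (e : ι → V)
    (h : Submodule.span ℂ (Set.range e) ⊔ sqr br ⊤ = ⊤) : Generates br e := by
  intro S he hS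
  refine eq_top_of_sup_sqr br hL hnil S hS ?_
  have h1 : Submodule.span ℂ (Set.range e) ≤ S := by
    refine Submodule.span_le.2 ?_
    rintro _ ⟨i, rfl⟩
    exact he i
  have h2 : Submodule.span ℂ (Set.range e) ⊔ sqr br ⊤ ≤ S ⊔ sqr br ⊤ :=
    sup_le (h1.trans le_sup_left) le_sup_right
  rwa [h, top_le_iff] at h2

theorem Generates.der_ext {br : Bil V} {ι : Type} {e : ι → V} (he : Generates br e)
    {D D' : Module.End ℂ V} (hD : IsDer br D) (hD' : IsDer br D') (h : ∀ i, D (e i) = D' (e i)) :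
    D = D' := by
  have := he (LinearMap.eqLocus D D') h (by
    intro x hx y hy
    rw [LinearMap.mem_eqLocus] at *
    rw [hD, hD', hx, hy])
  apply LinearMap.ext
  intro x
  have hx : x ∈ LinearMap.eqLocus D D' := by rw [this]; trivial
  exact hx

theorem Generates.sup {br : Bil V} {ι : Type} {e : ι → V} (he : Generates br e) :
    Submodule.span ℂ (Set.range e) ⊔ sqr br ⊤ = ⊤ := by
  apply he
  · intro i
    exact Submodule.mem_sup_left (Submodule.subset_span ⟨i, rfl⟩)
  · intro x _ y _
    exact Submodule.mem_sup_right (br_mem_sqr br x y)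

theorem br_iSup_mem (br : Bil V) {ι κ : Type*} {A : ι → Submodule ℂ V} {B : κ → Submodule ℂ V}
    {U : Submodule ℂ V} (h : ∀ i j, ∀ x ∈ A i, ∀ y ∈ B j, br x y ∈ U) :
    ∀ x ∈ ⨆ i, A i, ∀ y ∈ ⨆ j, B j, br x y ∈ U := by
  have h1 : ∀ i, ∀ x ∈ A i, ∀ y ∈ ⨆ j, B j, br x y ∈ U := by
    intro i x hx
    have : ⨆ j, B j ≤ U.comap (br x) := iSup_le (fun j y hy => h i j x hx y hy)
    exact fun y hy => this hy
  intro x hx y hy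
  have : ⨆ i, A i ≤ U.comap (br.flip y) := iSup_le (fun i x hx => h1 i x hx y hy)
  exact this hx

/-- A family of subspaces indexed by `ℂ` which multiplies additively. -/
def IsMulGraded (br : Bil V) (E : ℂ → Submodule ℂ V) : Prop :=
  ∀ μ ν, ∀ x ∈ E μ, ∀ y ∈ E ν, br x y ∈ E (μ + ν)

/-- The part of degree at least `p`. -/
def geq (E : ℂ → Submodule ℂ V) (p : ℕ) : Submodule ℂ V := ⨆ n : ℕ, E ((p + n : ℕ) : ℂ)

theorem le_geq (E : ℂ → Submodule ℂ V) {p m : ℕ} (h : p ≤ m) : E (m : ℂ) ≤ geq E p := by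
  obtain ⟨n, rfl⟩ := Nat.exists_eq_add_of_le h
  exact le_iSup (fun n : ℕ => E ((p + n : ℕ) : ℂ)) n

theorem geq_anti (E : ℂ → Submodule ℂ V) {p q : ℕ} (h : p ≤ q) : geq E q ≤ geq E p :=
  iSup_le fun n => le_geq E (by omega)

theorem geq_mul {br : Bil V} {E : ℂ → Submodule ℂ V} (hE : IsMulGraded br E) (p q : ℕ) :
    ∀ x ∈ geq E p, ∀ y ∈ geq E q, br x y ∈ geq E (p + q) := by
  refine br_iSup_mem br ?_
  intro m n x hx y hy
  have := hE _ _ x hx y hy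
  rw [← Nat.cast_add] at this
  exact le_geq E (by omega) this

theorem geq_eq_top {br : Bil V} {E : ℂ → Submodule ℂ V} (hE : IsMulGraded br E) {ι : Type}
    {e : ι → V} (he : Generates br e) (p : ℕ) (h : ∀ i, ∃ n : ℕ, p ≤ n ∧ e i ∈ E (n : ℂ)) :
    geq E p = ⊤ := by
  apply he
  · intro i
    obtain ⟨n, hn, hi⟩ := h i
    exact le_geq E hn hi
  · intro x hx y hy
    exact geq_anti E (by omega) (geq_mul hE p p x hx y hy)

theorem sqr_le_geq {br : Bil V} {E : ℂ → Submodule ℂ V} (hE : IsMulGraded br E) (p : ℕ)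
    (h : geq E p = ⊤) : sqr br ⊤ ≤ geq E (p + p) := by
  refine Submodule.span_le.2 ?_
  rintro _ ⟨x, hx, y, hy, rfl⟩
  rw [← h] at hx hy
  exact geq_mul hE p p x hx y hy

theorem eigenspace_mulGraded {br : Bil V} {D : Module.End ℂ V} (hD : IsDer br D) :
    IsMulGraded br D.eigenspace := by
  intro μ ν x hx y hy
  rw [Module.End.mem_eigenspace_iff] at *
  rw [hD, hx, hy]
  simp [add_smul]

theorem maxGen_mulGraded {br : Bil V} {D : Module.End ℂ V} (hD : IsDer br D) :
    IsMulGraded br D.maxGenEigenspace := by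
  intro μ ν
  have key : ∀ n a b : ℕ, a + b = n → ∀ x y, ((D - μ • 1) ^ a) x = 0 → ((D - ν • 1) ^ b) y = 0 →
      br x y ∈ D.maxGenEigenspace (μ + ν) := by
    intro n
    induction n with
    | zero =>
      intro a b hab x y hx hy
      obtain rfl : a = 0 := by omega
      have : x = 0 := by simpa using hx
      simp [this]
    | succ n ih =>
      intro a b hab x y hx hy
      obtain _ | a := a
      · have : x = 0 := by simpa using hx
        simp [this]
      obtain _ | b := b
      · have : y = 0 := by simpa using hy
        simp [this]
      have h1 := ih a (b + 1) (by omega) ((D - μ • 1) x) y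
        (by rwa [pow_succ, Module.End.mul_apply] at hx) hy
      have h2 := ih (a + 1) b (by omega) x ((D - ν • 1) y) hx
        (by rwa [pow_succ, Module.End.mul_apply] at hy)
      have h3 : (D - (μ + ν) • (1 : Module.End ℂ V)) (br x y) ∈ D.maxGenEigenspace (μ + ν) := by
        have e : (D - (μ + ν) • (1 : Module.End ℂ V)) (br x y) =
            br ((D - μ • 1) x) y + br x ((D - ν • 1) y) := by
          simp only [LinearMap.sub_apply, LinearMap.smul_apply, Module.End.one_apply, map_sub,
            map_smul, hD x y]
          rw [add_smul]
          abel
        rw [e]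
        exact Submodule.add_mem _ h1 h2
      rw [Module.End.mem_maxGenEigenspace] at h3 ⊢
      obtain ⟨k, hk⟩ := h3
      exact ⟨k + 1, by rw [pow_succ, Module.End.mul_apply]; exact hk⟩
  intro x hx y hy
  rw [Module.End.mem_maxGenEigenspace] at hx hy
  obtain ⟨a, ha⟩ := hx
  obtain ⟨b, hb⟩ := hy
  exact key _ a b rfl x y ha hb

theorem der_sqr {br : Bil V} {D : Module.End ℂ V} (hD : IsDer br D) {x : V}
    (hx : x ∈ sqr br (⊤ : Submodule ℂ V)) : D x ∈ sqr br (⊤ : Submodule ℂ V) := by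
  have : sqr br (⊤ : Submodule ℂ V) ≤ (sqr br ⊤).comap D := by
    refine Submodule.span_le.2 ?_
    rintro _ ⟨x, hx, y, hy, rfl⟩
    show D (br x y) ∈ sqr br ⊤
    rw [hD]
    exact Submodule.add_mem _ (br_mem_sqr br _ _) (br_mem_sqr br _ _)
  exact this hx

/-- Lifting generalised eigenvectors through an invariant subspace. -/
theorem lift_maxGen [FiniteDimensional ℂ V] (T : Module.End ℂ V) (U : Submodule ℂ V)
    (hU : ∀ x ∈ U, T x ∈ U) (μ : ℂ) (n : ℕ) (y : V) (hy : ((T - μ • 1) ^ n) y ∈ U) :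
    ∃ z ∈ T.maxGenEigenspace μ, y - z ∈ U := by
  obtain ⟨q, hq, hnd⟩ := Polynomial.exists_eq_pow_rootMultiplicity_mul_and_not_dvd T.charpoly
    (LinearMap.charpoly_monic T).ne_zero μ
  have hcop : IsCoprime q ((Polynomial.X - Polynomial.C μ) ^ n) := by
    apply IsCoprime.pow_right
    apply IsCoprime.symm
    exact (Polynomial.irreducible_X_sub_C μ).coprime_iff_not_dvd.2 hnd
  obtain ⟨a, b, hab⟩ := hcop
  have hpoly : ∀ (f : Polynomial ℂ), ∀ x ∈ U, Polynomial.aeval T f x ∈ U := by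
    intro f x hx
    have hpow : ∀ m : ℕ, (T ^ m) x ∈ U := by
      intro m
      induction m with
      | zero => simpa using hx
      | succ m ih => rw [pow_succ', Module.End.mul_apply]; exact hU _ ih
    rw [Polynomial.aeval_eq_sum_range, LinearMap.sum_apply]
    exact Submodule.sum_mem _ (fun i _ => Submodule.smul_mem _ _ (hpow i))
  have hX : Polynomial.aeval T (Polynomial.X - Polynomial.C μ) = T - μ • 1 := by
    simp [Algebra.algebraMap_eq_smul_one]
  refine ⟨Polynomial.aeval T (a * q) y, ?_, ?_⟩
  · rw [Module.End.mem_maxGenEigenspace]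
    refine ⟨T.charpoly.rootMultiplicity μ, ?_⟩
    rw [← hX, ← map_pow, ← Module.End.mul_apply, ← map_mul]
    have : (Polynomial.X - Polynomial.C μ) ^ (T.charpoly.rootMultiplicity μ) * (a * q)
        = a * T.charpoly := by
      conv_rhs => rw [hq]
      ring
    rw [this, map_mul, LinearMap.aeval_self_charpoly]
    simp
  · have h1 : y = Polynomial.aeval T (a * q + b * (Polynomial.X - Polynomial.C μ) ^ n) y := by
      rw [hab]; simp
    have h2 : y - Polynomial.aeval T (a * q) y = Polynomial.aeval T b (((T - μ • 1) ^ n) y) := by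
      rw [map_add (Polynomial.aeval T), LinearMap.add_apply, map_mul _ b, map_pow, hX,
        Module.End.mul_apply] at h1
      rw [sub_eq_iff_eq_add, add_comm]
      exact h1
    rw [h2]
    exact hpoly b _ hy

/-- Linear maps can be prescribed on the eigenspaces of a diagonalisable operator. -/
theorem exists_extend {W : Type v} [AddCommGroup W] [Module ℂ W] (f : Module.End ℂ V)
    (hf : ⨆ μ : ℂ, f.eigenspace μ = ⊤) (T : ℂ → V →ₗ[ℂ] W) :
    ∃ G : V →ₗ[ℂ] W, ∀ μ, ∀ x ∈ f.eigenspace μ, G x = T μ x := by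
  classical
  have hI : DirectSum.IsInternal f.eigenspace :=
    DirectSum.isInternal_submodule_of_iSupIndep_of_iSup_eq_top f.eigenspaces_iSupIndep hf
  let e := LinearEquiv.ofBijective (DirectSum.coeLinearMap f.eigenspace) hI
  refine ⟨(DirectSum.toModule ℂ ℂ W (fun μ => (T μ).comp (f.eigenspace μ).subtype)).comp
    e.symm.toLinearMap, ?_⟩
  intro μ x hx
  have : e.symm x = DirectSum.lof ℂ ℂ (fun μ => f.eigenspace μ) μ ⟨x, hx⟩ := by
    rw [LinearEquiv.symm_apply_eq]
    show x = DirectSum.coeLinearMap f.eigenspace _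
    rw [DirectSum.coeLinearMap_lof]
  simp [this]

end Gen

/-! ### Systems of weight generators and their conjugacy -/

section Sys
variable {V : Type u} [AddCommGroup V] [Module ℂ V]

/-- Generators `e i`, dual functionals `lam i` vanishing on brackets, and a diagonal torus of
derivations `D i`. -/
structure IsSys (br : Bil V) {k : ℕ} (e : Fin k → V) (lam : Fin k → V →ₗ[ℂ] ℂ)
    (D : Fin k → Module.End ℂ V) : Prop where
  gen : Generates br e
  lam_br : ∀ i x y, lam i (br x y) = 0
  lam_e : ∀ i j, lam i (e j) = if i = j then 1 else 0
  der : ∀ i, IsDer br (D i)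
  D_e : ∀ i j, D i (e j) = if i = j then e j else 0

theorem lam_sqr {br : Bil V} {l : V →ₗ[ℂ] ℂ} (h : ∀ x y, l (br x y) = 0) {x : V}
    (hx : x ∈ sqr br (⊤ : Submodule ℂ V)) : l x = 0 := by
  have : sqr br (⊤ : Submodule ℂ V) ≤ LinearMap.ker l := by
    refine Submodule.span_le.2 ?_
    rintro _ ⟨x, hx, y, hy, rfl⟩
    exact h x y
  exact this hx

variable {br : Bil V} {k : ℕ} {e f : Fin k → V} {lam lam' : Fin k → V →ₗ[ℂ] ℂ}
  {D D' : Fin k → Module.End ℂ V}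

theorem IsSys.lam_D (S : IsSys br e lam D) (l i : Fin k) (x : V) :
    lam l (D i x) = if l = i then lam i x else 0 := by
  have h := S.gen (LinearMap.eqLocus ((lam l).comp (D i)) (if l = i then lam i else 0)) (by
    intro j
    rw [LinearMap.mem_eqLocus, LinearMap.comp_apply, S.D_e]
    by_cases hij : i = j
    · subst hij
      by_cases hl : l = i
      · simp [hl]
      · simp [hl, S.lam_e]
    · by_cases hl : l = i
      · simp [hl, hij, S.lam_e]
      · simp [hl, hij]) (by
    intro x _ y _
    rw [LinearMap.mem_eqLocus, LinearMap.comp_apply, S.der, map_add, S.lam_br, S.lam_br]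
    by_cases hl : l = i
    · simp [hl, S.lam_br]
    · simp [hl])
  have hx : x ∈ LinearMap.eqLocus ((lam l).comp (D i)) (if l = i then lam i else 0) := by
    rw [h]; trivial
  rw [LinearMap.mem_eqLocus, LinearMap.comp_apply] at hx
  rw [hx]
  by_cases hl : l = i
  · simp [hl]
  · simp [hl]

theorem IsSys.sub_mem (S : IsSys br e lam D) (x : V) :
    x - ∑ i, lam i x • e i ∈ sqr br (⊤ : Submodule ℂ V) := by
  have hx : x ∈ Submodule.span ℂ (Set.range e) ⊔ sqr br ⊤ := by rw [S.gen.sup]; trivial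
  obtain ⟨y, hy, z, hz, rfl⟩ := Submodule.mem_sup.1 hx
  obtain ⟨c, rfl⟩ := (Submodule.mem_span_range_iff_exists_fun ℂ).1 hy
  have hl : ∀ i, lam i (∑ j, c j • e j + z) = c i := by
    intro i
    rw [map_add, lam_sqr (S.lam_br i) hz, map_sum]
    simp [S.lam_e]
  simp only [hl]
  simpa using hz

theorem IsSys.mem_sqr (S : IsSys br e lam D) {x : V} (h : ∀ i, lam i x = 0) :
    x ∈ sqr br (⊤ : Submodule ℂ V) := by
  have := S.sub_mem x
  simpa [h] using this

theorem IsSys.map (S : IsSys br e lam D) {g : V ≃ₗ[ℂ] V} (hg : IsAut br g) :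
    IsSys br (fun i => g (e i)) (fun i => (lam i).comp g.symm.toLinearMap)
      (fun i => g.toLinearMap * D i * g.symm.toLinearMap) := by
  have hg' : ∀ x y, g.symm (br x y) = br (g.symm x) (g.symm y) := by
    intro x y
    rw [LinearEquiv.symm_apply_eq, hg]
    simp
  refine ⟨?_, ?_, ?_, ?_, ?_⟩
  · intro T hT hT'
    have h := S.gen (T.comap g.toLinearMap) hT (by
      intro x hx y hy
      show g (br x y) ∈ T
      rw [hg]
      exact hT' _ hx _ hy)
    rw [eq_top_iff]
    intro x _
    have hx : g.symm x ∈ T.comap g.toLinearMap := by rw [h]; trivial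
    simpa using hx
  · intro i x y
    show lam i (g.symm (br x y)) = 0
    rw [hg', S.lam_br]
  · intro i j
    show lam i (g.symm (g (e j))) = _
    rw [LinearEquiv.symm_apply_apply, S.lam_e]
  · intro i x y
    show g (D i (g.symm (br x y))) = br (g (D i (g.symm x))) y + br x (g (D i (g.symm y)))
    rw [hg', S.der, map_add, hg, hg]
    simp
  · intro i j
    show g (D i (g.symm (g (e j)))) = _
    rw [LinearEquiv.symm_apply_apply, S.D_e]
    by_cases h : i = j <;> simp [h]

theorem sqr_aut {g : V ≃ₗ[ℂ] V} (hg : IsAut br g) {x : V}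
    (hx : x ∈ sqr br (⊤ : Submodule ℂ V)) : g x ∈ sqr br (⊤ : Submodule ℂ V) := by
  have : sqr br (⊤ : Submodule ℂ V) ≤ (sqr br ⊤).comap g.toLinearMap := by
    refine Submodule.span_le.2 ?_
    rintro _ ⟨x, hx, y, hy, rfl⟩
    show g (br x y) ∈ sqr br ⊤
    rw [hg]
    exact br_mem_sqr br _ _
  exact this hx

/-- Spectral projections of a diagonalisable operator. -/
theorem exists_proj (F : Module.End ℂ V) (hF : ⨆ μ : ℂ, F.eigenspace μ = ⊤) :
    ∃ π : ℂ → Module.End ℂ V, (∀ ν, ∀ x ∈ F.eigenspace ν, π ν x = x) ∧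
      (∀ ν μ, ν ≠ μ → ∀ x ∈ F.eigenspace μ, π ν x = 0) ∧ ∀ ν x, π ν x ∈ F.eigenspace ν := by
  classical
  have h : ∀ ν, ∃ G : V →ₗ[ℂ] V, ∀ μ, ∀ x ∈ F.eigenspace μ,
      G x = (if ν = μ then (LinearMap.id : V →ₗ[ℂ] V) else 0) x :=
    fun ν => exists_extend F hF (fun μ => if ν = μ then LinearMap.id else 0)
  choose π hπ using h
  refine ⟨π, ?_, ?_, ?_⟩
  · intro ν x hx
    rw [hπ ν ν x hx]; simp
  · intro ν μ hne x hx
    rw [hπ ν μ x hx]; simp [hne]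
  · intro ν x
    have : ⨆ μ : ℂ, F.eigenspace μ ≤ (F.eigenspace ν).comap (π ν) := by
      refine iSup_le ?_
      intro μ x hx
      show π ν x ∈ F.eigenspace ν
      rw [hπ ν μ x hx]
      by_cases h : ν = μ
      · subst h; simpa using hx
      · simp [h]
    have hx : x ∈ ⨆ μ : ℂ, F.eigenspace μ := by rw [hF]; trivial
    exact this hx

theorem bil_ext {W : Type v} [AddCommGroup W] [Module ℂ W] {ι κ : Type*}
    {A : ι → Submodule ℂ V} {B : κ → Submodule ℂ V}
    {P Q : V →ₗ[ℂ] V →ₗ[ℂ] W} (h : ∀ i j, ∀ x ∈ A i, ∀ y ∈ B j, P x y = Q x y) :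
    ∀ x ∈ ⨆ i, A i, ∀ y ∈ ⨆ j, B j, P x y = Q x y := by
  have h1 : ∀ i, ∀ x ∈ A i, ∀ y ∈ ⨆ j, B j, P x y = Q x y := by
    intro i x hx
    have : ⨆ j, B j ≤ LinearMap.eqLocus (P x) (Q x) := iSup_le (fun j y hy => h i j x hx y hy)
    exact fun y hy => this hy
  intro x hx y hy
  have : ⨆ i, A i ≤ LinearMap.eqLocus (P.flip y) (Q.flip y) :=
    iSup_le (fun i x hx => h1 i x hx y hy)
  exact this hx

theorem exists_exp [FiniteDimensional ℂ V] {d : Module.End ℂ V} (hd : IsDer br d)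
    (hn : IsNilpotent d) :
    ∃ g : V ≃ₗ[ℂ] V, IsAut br g ∧ (∀ x, d x = 0 → g x = x) ∧
      (∀ x, d (d x) = 0 → g x = x + d x) := by
  letI : Module ℚ V := Module.compHom V (algebraMap ℚ ℂ)
  letI : NonUnitalNonAssocRing V :=
    { (inferInstance : AddCommGroup V) with
      mul := fun x y => br x y
      left_distrib := fun x y z => map_add (br x) y z
      right_distrib := fun x y z => by
        show br (x + y) z = br x z + br y z
        simp
      zero_mul := fun x => by
        show br 0 x = 0
        simp
      mul_zero := fun x => by
        show br x 0 = 0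
        simp }
  have hmul : ∀ x y : V, x * y = br x y := fun _ _ => rfl
  haveI : SMulCommClass ℂ V V := ⟨fun c x y => by simp [hmul]⟩
  haveI : IsScalarTower ℂ V V := ⟨fun c x y => by simp [hmul]⟩
  have hexp := Module.End.exp_mul_of_derivation ℂ V d (fun x y => by
    simp only [hmul]
    rw [hd, add_comm]) hn
  have hinv1 := IsNilpotent.exp_mul_exp_neg_self hn
  have hinv2 := IsNilpotent.exp_neg_mul_exp_self hn
  let g : V ≃ₗ[ℂ] V := LinearEquiv.ofLinear (IsNilpotent.exp d) (IsNilpotent.exp (-d)) hinv1 hinv2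
  have hg : ∀ x, g x = IsNilpotent.exp d x := fun _ => rfl
  refine ⟨g, ?_, ?_, ?_⟩
  · intro x y
    exact hexp x y
  · intro x hx
    have := IsNilpotent.exp_smul_eq_sum (a := d) (m := x) (k := 1) (by simpa using hx) hn
    rw [hg]
    simpa using this
  · intro x hx
    have := IsNilpotent.exp_smul_eq_sum (a := d) (m := x) (k := 2)
      (by simpa [pow_two] using hx) hn
    rw [hg]
    simpa [Finset.sum_range_succ] using this

theorem iSup_eigen_of_geq {F : Module.End ℂ V} {p : ℕ} (h : geq F.eigenspace p = ⊤) :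
    ⨆ μ : ℂ, F.eigenspace μ = ⊤ := by
  rw [eq_top_iff, ← h]
  exact iSup_le fun n => le_iSup F.eigenspace _

theorem IsSys.step [FiniteDimensional ℂ V] (S : IsSys br e lam D) (S' : IsSys br f lam' D')
    (j : Fin k) : ∃ g : V ≃ₗ[ℂ] V, IsAut br g ∧ ∃ i, lam' j (e i) ≠ 0 ∧
      (∃ c : ℂ, c ≠ 0 ∧ g (e i) - c • f j ∈ sqr br (⊤ : Submodule ℂ V)) ∧
      ∀ l, l ≠ i → g (e l) = e l := by
  -- choose `i`
  obtain ⟨i, hi⟩ : ∃ i, lam i (f j) * lam' j (e i) ≠ 0 := by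
    by_contra hcon
    push Not at hcon
    have h1 := lam_sqr (S'.lam_br j) (S.sub_mem (f j))
    rw [map_sub, map_sum, S'.lam_e] at h1
    simp [hcon] at h1
  have hb : lam i (f j) ≠ 0 := left_ne_zero_of_mul hi
  have ha : lam' j (e i) ≠ 0 := right_ne_zero_of_mul hi
  set E := (D i).eigenspace with hE
  have hmul : IsMulGraded br E := eigenspace_mulGraded (S.der i)
  have hei : e i ∈ E 1 := by
    rw [hE, Module.End.mem_eigenspace_iff, S.D_e]; simp
  have hel : ∀ l, l ≠ i → e l ∈ E 0 := by
    intro l hl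
    rw [hE, Module.End.mem_eigenspace_iff, S.D_e]
    simp [hl.symm]
  have h0 : geq E 0 = ⊤ := by
    refine geq_eq_top hmul S.gen 0 ?_
    intro l
    by_cases hl : l = i
    · subst hl; exact ⟨1, by omega, by simpa using hei⟩
    · exact ⟨0, le_refl _, by simpa using hel l hl⟩
  have htop := iSup_eigen_of_geq h0
  obtain ⟨π, hπ1, hπ2, hπ3⟩ := exists_proj (D i) htop
  obtain ⟨d, hd⟩ := exists_extend (D i) htop (fun μ => (π (μ - 1)) * (D' j))
  simp only [Module.End.mul_apply] at hd
  have hmem : ∀ x, x ∈ ⨆ μ : ℂ, E μ := fun x => by rw [htop]; trivial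
  have hprojr : ∀ κ ν, ∀ y ∈ E ν, ∀ z, π (κ + ν) (br z y) = br (π κ z) y := by
    intro κ ν y hy z
    have : ⨆ μ : ℂ, E μ ≤ LinearMap.eqLocus ((π (κ + ν)).comp (br.flip y))
        ((br.flip y).comp (π κ)) := by
      refine iSup_le fun μ z hz => ?_
      show π (κ + ν) (br z y) = br (π κ z) y
      by_cases h : κ = μ
      · subst h
        rw [hπ1 _ _ (hmul _ _ z hz y hy), hπ1 _ _ hz]
      · rw [hπ2 _ (μ + ν) (by simpa using h) _ (hmul _ _ z hz y hy), hπ2 _ _ h _ hz]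
        simp
    exact this (hmem z)
  have hprojl : ∀ κ ν, ∀ y ∈ E ν, ∀ z, π (ν + κ) (br y z) = br y (π κ z) := by
    intro κ ν y hy z
    have : ⨆ μ : ℂ, E μ ≤ LinearMap.eqLocus ((π (ν + κ)).comp (br y))
        ((br y).comp (π κ)) := by
      refine iSup_le fun μ z hz => ?_
      show π (ν + κ) (br y z) = br y (π κ z)
      by_cases h : κ = μ
      · subst h
        rw [hπ1 _ _ (hmul _ _ y hy z hz), hπ1 _ _ hz]
      · rw [hπ2 _ (ν + μ) (by simpa using h) _ (hmul _ _ y hy z hz), hπ2 _ _ h _ hz]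
        simp
    exact this (hmem z)
  have hder : IsDer br d := by
    intro x y
    refine bil_ext (P := br.compr₂ d) (Q := br.comp d + br.compl₂ d) (A := E) (B := E) ?_
      x (hmem x) y (hmem y)
    intro μ ν x hx y hy
    show d (br x y) = br (d x) y + br x (d y)
    rw [hd _ _ (hmul _ _ x hx y hy), hd _ _ hx, hd _ _ hy, S'.der, map_add,
      show μ + ν - 1 = (μ - 1) + ν by ring, hprojr _ _ y hy,
      show (μ - 1) + ν = μ + (ν - 1) by ring, hprojl _ _ x hx]
  have hneg : ∀ x, π (-1) x = 0 := by
    intro x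
    have : geq E 0 ≤ LinearMap.ker (π (-1)) := by
      refine iSup_le fun n x hx => ?_
      refine hπ2 (-1) _ ?_ x hx
      intro hc
      have h3 : ((0 + n + 1 : ℕ) : ℂ) = 0 := by push_cast at hc ⊢; rw [← hc]; ring
      exact absurd (Nat.cast_eq_zero.1 h3) (by omega)
    rw [h0] at this
    exact this trivial
  have hd0 : ∀ x ∈ E 0, d x = 0 := by
    intro x hx
    rw [hd 0 x hx, zero_sub, hneg]
  have hnil : IsNilpotent d := by
    rw [Module.End.isNilpotent_iff_of_finite]
    have hpow : ∀ n : ℕ, ∀ x ∈ E (n : ℂ), (d ^ (n + 1)) x = 0 := by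
      intro n
      induction n with
      | zero =>
        intro x hx
        rw [zero_add, pow_one]
        exact hd0 x (by simpa using hx)
      | succ n ih =>
        intro x hx
        rw [pow_succ, Module.End.mul_apply]
        apply ih
        rw [hd _ _ hx]
        have := hπ3 (((n + 1 : ℕ) : ℂ) - 1) (D' j x)
        rwa [show (((n + 1 : ℕ) : ℂ) - 1) = (n : ℂ) by push_cast; ring] at this ⊢
    intro x
    have hx : x ∈ geq E 0 := by rw [h0]; trivial
    induction hx using Submodule.iSup_induction' with
    | mem n x hx => exact ⟨_, hpow _ x hx⟩
    | zero => exact ⟨0, by simp⟩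
    | add x y _ _ h1 h2 =>
      obtain ⟨a, ha⟩ := h1
      obtain ⟨b, hb⟩ := h2
      refine ⟨a + b, ?_⟩
      rw [map_add]
      nth_rewrite 1 [add_comm a b]
      rw [pow_add, pow_add, Module.End.mul_apply, Module.End.mul_apply, ha, hb]
      simp
  -- the linear part of `d (e i)`
  have hdei : d (e i) = π 0 (D' j (e i)) := by rw [hd 1 _ hei]; simp
  have hdE0 : d (e i) ∈ E 0 := by rw [hdei]; exact hπ3 0 _
  have hlam1 : lam i (d (e i)) = 0 := by
    have h1 := S.lam_D i i (d (e i))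
    rw [hE, Module.End.mem_eigenspace_iff] at hdE0
    rw [hdE0] at h1
    simpa using h1.symm
  have hlamπ : ∀ l, l ≠ i → ∀ x, lam l (π 0 x) = lam l x := by
    intro l hl x
    have : ⨆ μ : ℂ, E μ ≤ LinearMap.eqLocus ((lam l).comp (π 0)) (lam l) := by
      refine iSup_le fun μ x hx => ?_
      show lam l (π 0 x) = lam l x
      by_cases h : μ = 0
      · subst h; rw [hπ1 _ _ hx]
      · rw [hπ2 _ _ (Ne.symm h) _ hx, map_zero]
        have h1 := S.lam_D l i x
        rw [Module.End.mem_eigenspace_iff.1 hx, map_smul, if_neg hl] at h1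
        exact ((smul_eq_zero.1 h1).resolve_left h).symm
    exact this (hmem x)
  have hD'sq : D' j (e i) - lam' j (e i) • f j ∈ sqr br (⊤ : Submodule ℂ V) := by
    apply S'.mem_sqr
    intro l
    rw [map_sub, S'.lam_D, map_smul, S'.lam_e]
    by_cases h : l = j <;> simp [h]
  have hlam2 : ∀ l, l ≠ i → lam l (d (e i)) = lam' j (e i) * lam l (f j) := by
    intro l hl
    rw [hdei, hlamπ l hl]
    have := lam_sqr (S.lam_br l) hD'sq
    rw [map_sub, map_smul, sub_eq_zero] at this
    exact this
  -- exponentiate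
  set s : ℂ := (lam' j (e i))⁻¹ * (lam i (f j))⁻¹ with hs
  have hder' : IsDer br (s • d) := by
    intro x y
    simp only [LinearMap.smul_apply, hder x y, smul_add, map_smul]
  obtain ⟨g, hg, hg1, hg2⟩ := exists_exp hder' (hnil.smul s)
  refine ⟨g, hg, i, ha, ⟨(lam i (f j))⁻¹, inv_ne_zero hb, ?_⟩, ?_⟩
  · rw [hg2 (e i) (by simp [hd0 _ hdE0])]
    apply S.mem_sqr
    intro l
    rw [map_sub, map_add, LinearMap.smul_apply, map_smul, map_smul, S.lam_e]
    by_cases h : l = i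
    · subst h
      simp [hlam1, hb]
    · rw [hlam2 l h, if_neg h, hs, smul_eq_mul, smul_eq_mul]
      field_simp
      ring
  · intro l hl
    exact hg1 _ (by simp [hd0 _ (hel l hl)])

theorem IsSys.align [FiniteDimensional ℂ V] (S : IsSys br e lam D) (S' : IsSys br f lam' D')
    (m : ℕ) : ∃ g : V ≃ₗ[ℂ] V, IsAut br g ∧ ∀ j : Fin k, (j : ℕ) < m → ∃ i, ∃ c : ℂ, c ≠ 0 ∧
      g (e i) - c • f j ∈ sqr br (⊤ : Submodule ℂ V) := by
  induction m with
  | zero => exact ⟨LinearEquiv.refl ℂ V, fun _ _ => rfl, fun j hj => absurd hj (by omega)⟩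
  | succ m ih =>
    obtain ⟨g, hg, hgj⟩ := ih
    by_cases hm : m < k
    · obtain ⟨g', hg', i, hi, ⟨c, hc, hci⟩, hl⟩ := (S.map hg).step S' ⟨m, hm⟩
      refine ⟨g.trans g', ?_, ?_⟩
      · intro x y
        show g' (g (br x y)) = br (g' (g x)) (g' (g y))
        rw [hg, hg']
      · intro j hj
        by_cases hjm : (j : ℕ) = m
        · obtain rfl : j = ⟨m, hm⟩ := Fin.ext hjm
          exact ⟨i, c, hc, hci⟩
        · obtain ⟨i', c', hc', hi'⟩ := hgj j (by omega)
          refine ⟨i', c', hc', ?_⟩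
          have hne : i' ≠ i := by
            rintro rfl
            apply hi
            have h1 := lam_sqr (S'.lam_br ⟨m, hm⟩) hi'
            rw [map_sub, map_smul, S'.lam_e, if_neg, smul_zero, sub_zero] at h1
            · exact h1
            · intro h; apply hjm; rw [← h]
          show g' (g (e i')) - c' • f j ∈ _
          rw [hl i' hne]
          exact hi'
    · exact ⟨g, hg, fun j _ => hgj j (by omega)⟩

/-- The total grading operator. -/
theorem IsSys.total (S : IsSys br e lam D) : ∃ T : Module.End ℂ V, IsDer br T ∧
    ∀ i, e i ∈ T.eigenspace ((1 : ℕ) : ℂ) := by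
  refine ⟨∑ i, D i, ?_, ?_⟩
  · intro x y
    simp only [LinearMap.sum_apply, S.der _ x y, Finset.sum_add_distrib, map_sum]
  · intro i
    rw [Module.End.mem_eigenspace_iff, LinearMap.sum_apply]
    simp [S.D_e]

theorem IsSys.final (S : IsSys br e lam D) (S' : IsSys br f lam' D') :
    ∃ ψ : V →ₗ[ℂ] V, (∀ x y, ψ (br x y) = br (ψ x) (ψ y)) ∧
      ∀ i j, ∀ c : ℂ, e i - c • f j ∈ sqr br (⊤ : Submodule ℂ V) → ψ (e i) = c • f j := by
  obtain ⟨T, hT, hTe⟩ := S.total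
  obtain ⟨T', hT', hTf⟩ := S'.total
  have hm := eigenspace_mulGraded hT
  have hm' := eigenspace_mulGraded hT'
  have h1 : geq T.eigenspace 1 = ⊤ :=
    geq_eq_top hm S.gen 1 fun i => ⟨1, le_refl _, hTe i⟩
  have h1' : geq T'.eigenspace 1 = ⊤ :=
    geq_eq_top hm' S'.gen 1 fun i => ⟨1, le_refl _, hTf i⟩
  have htop := iSup_eigen_of_geq h1
  obtain ⟨π, hπ1, hπ2, hπ3⟩ := exists_proj T htop
  obtain ⟨π', hπ1', hπ2', hπ3'⟩ := exists_proj T' (iSup_eigen_of_geq h1')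
  have hQ : (⨆ p : ℕ, T.eigenspace (p : ℂ) ⊓ geq T'.eigenspace p) = ⊤ := by
    apply S.gen
    · intro i
      refine Submodule.mem_iSup_of_mem 1 ⟨hTe i, ?_⟩
      rw [h1']; trivial
    · refine br_iSup_mem br ?_
      intro p q x hx y hy
      refine Submodule.mem_iSup_of_mem (p + q) ⟨?_, ?_⟩
      · have := hm _ _ x hx.1 y hy.1
        rwa [← Nat.cast_add] at this
      · exact geq_mul hm' p q x hx.2 y hy.2
  have hfil : ∀ p : ℕ, T.eigenspace (p : ℂ) ≤ geq T'.eigenspace p := by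
    intro p x hx
    have : (⨆ p : ℕ, T.eigenspace (p : ℂ) ⊓ geq T'.eigenspace p) ≤
        (geq T'.eigenspace p).comap (π (p : ℂ)) := by
      refine iSup_le fun q z hz => ?_
      show π (p : ℂ) z ∈ geq T'.eigenspace p
      by_cases h : p = q
      · subst h
        rw [hπ1 _ _ hz.1]
        exact hz.2
      · rw [hπ2 _ (q : ℂ) (by exact_mod_cast h) _ hz.1]
        exact Submodule.zero_mem _
    have h2 : π (p : ℂ) x ∈ geq T'.eigenspace p := by
      apply this
      rw [hQ]; trivial
    rwa [hπ1 _ _ hx] at h2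
  obtain ⟨ψ, hψ⟩ := exists_extend T htop π'
  have hlead : ∀ p q : ℕ, ∀ x ∈ geq T'.eigenspace p, ∀ y ∈ geq T'.eigenspace q,
      π' ((p + q : ℕ) : ℂ) (br x y) = br (π' (p : ℂ) x) (π' (q : ℂ) y) := by
    intro p q
    refine bil_ext (P := br.compr₂ (π' ((p + q : ℕ) : ℂ)))
      (Q := (br.comp (π' (p : ℂ))).compl₂ (π' (q : ℂ))) ?_
    intro m n x hx y hy
    show π' ((p + q : ℕ) : ℂ) (br x y) = br (π' (p : ℂ) x) (π' (q : ℂ) y)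
    have hxy := hm' _ _ x hx y hy
    rw [← Nat.cast_add] at hxy
    by_cases hmz : m = 0
    · by_cases hnz : n = 0
      · subst hmz
        subst hnz
        rw [hπ1' _ _ (by simpa using hxy), hπ1' _ _ (by simpa using hx),
          hπ1' _ _ (by simpa using hy)]
      · rw [hπ2' _ _ (by intro h; have := Nat.cast_injective (R := ℂ) h; omega) _ hxy,
          hπ2' (q : ℂ) _ (by intro h; have := Nat.cast_injective (R := ℂ) h; omega) _ hy,
          map_zero]
    · rw [hπ2' _ _ (by intro h; have := Nat.cast_injective (R := ℂ) h; omega) _ hxy,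
        hπ2' (p : ℂ) _ (by intro h; have := Nat.cast_injective (R := ℂ) h; omega) _ hx,
        map_zero, LinearMap.zero_apply]
  refine ⟨ψ, ?_, ?_⟩
  · intro x y
    have hx : x ∈ geq T.eigenspace 1 := by rw [h1]; trivial
    have hy : y ∈ geq T.eigenspace 1 := by rw [h1]; trivial
    refine bil_ext (P := br.compr₂ ψ) (Q := (br.comp ψ).compl₂ ψ) ?_ x hx y hy
    intro m n x hx y hy
    show ψ (br x y) = br (ψ x) (ψ y)
    have hxy := hm _ _ x hx y hy
    rw [← Nat.cast_add] at hxy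
    rw [hψ _ _ hx, hψ _ _ hy, hψ _ _ hxy]
    exact hlead _ _ x (hfil _ hx) y (hfil _ hy)
  · intro i j c hc
    rw [hψ _ _ (hTe i)]
    have hz : ∀ z ∈ sqr br (⊤ : Submodule ℂ V), π' ((1 : ℕ) : ℂ) z = 0 := by
      intro z hz
      have hz2 := sqr_le_geq hm' 1 h1' hz
      have : geq T'.eigenspace (1 + 1) ≤ LinearMap.ker (π' ((1 : ℕ) : ℂ)) := by
        refine iSup_le fun n z hz => ?_
        exact hπ2' _ _ (by intro h; have := Nat.cast_injective (R := ℂ) h; omega) _ hz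
      exact this hz2
    have h3 := hz _ hc
    rw [map_sub, map_smul, hπ1' _ _ (hTf j), sub_eq_zero] at h3
    exact h3

/-- Any two systems are conjugate up to permutation and scaling. -/
theorem IsSys.conj [FiniteDimensional ℂ V] (S : IsSys br e lam D) (S' : IsSys br f lam' D') :
    ∃ g : V ≃ₗ[ℂ] V, IsAut br g ∧ ∃ σ : Equiv.Perm (Fin k), ∃ c : Fin k → ℂ, (∀ j, c j ≠ 0) ∧
      ∀ j, g (e (σ j)) = c j • f j := by
  obtain ⟨g, hg, h⟩ := S.align S' k
  have h' : ∀ j : Fin k, ∃ i, ∃ c : ℂ, c ≠ 0 ∧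
      g (e i) - c • f j ∈ sqr br (⊤ : Submodule ℂ V) := fun j => h j j.2
  choose τ c hc hτ using h'
  have hinj : Function.Injective τ := by
    intro j j' hjj
    by_contra hne
    have h1 := hτ j
    have h2 := hτ j'
    rw [← hjj] at h2
    have h3 := lam_sqr (S'.lam_br j) (Submodule.sub_mem _ h1 h2)
    simp only [map_sub, map_smul, S'.lam_e, if_neg hne] at h3
    apply hc j
    simpa using h3
  let σ : Equiv.Perm (Fin k) := Equiv.ofBijective τ (Finite.injective_iff_bijective.1 hinj)
  obtain ⟨ψ, hψ, hψe⟩ := (S.map hg).final S'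
  have hψj : ∀ j, ψ (g (e (σ j))) = c j • f j := fun j => hψe (τ j) j (c j) (hτ j)
  have hsurj : LinearMap.range ψ = ⊤ := by
    apply S'.gen
    · intro j
      refine ⟨(c j)⁻¹ • g (e (σ j)), ?_⟩
      rw [map_smul, hψj, smul_smul, inv_mul_cancel₀ (hc j), one_smul]
    · rintro _ ⟨x, rfl⟩ _ ⟨y, rfl⟩
      exact ⟨br x y, hψ x y⟩
  have hs : Function.Surjective ψ := LinearMap.range_eq_top.1 hsurj
  have hb : Function.Bijective ψ := ⟨LinearMap.injective_iff_surjective.2 hs, hs⟩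
  refine ⟨g.trans (LinearEquiv.ofBijective ψ hb), ?_, σ, c, hc, ?_⟩
  · intro x y
    show ψ (g (br x y)) = br (ψ (g x)) (ψ (g y))
    rw [hg, hψ]
  · intro j
    exact hψj j

end Sys

/-! ### Structure of the solvable extensions -/

section Ext
variable {V : Type u} [AddCommGroup V] [Module ℂ V]
variable {A : Type v} [AddCommGroup A] [Module ℂ A]

theorem lcs_prod_eq_zero (br : Bil A) (J : Submodule ℂ A) (n : ℕ)
    (h : ∀ zs : List A, (∀ z ∈ zs, z ∈ J) → zs.length = n → (zs.map br.flip).prod = 0) (m : ℕ) :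
    ∀ v ∈ lcs br J m, ∀ zs : List A, (∀ z ∈ zs, z ∈ J) → zs.length + m = n →
      ((zs.map br.flip).prod : Module.End ℂ A) v = 0 := by
  induction m with
  | zero =>
    intro v _ zs hz hl
    rw [h zs hz (by simpa using hl)]
    rfl
  | succ m ih =>
    intro v hv zs hz hl
    have : lcs br J (m + 1) ≤ LinearMap.ker ((zs.map br.flip).prod : Module.End ℂ A) := by
      refine Submodule.span_le.2 ?_
      rintro _ ⟨x, hx, y, hy, rfl⟩
      have := ih x hx (zs ++ [y]) (by
        intro z hz'
        rw [List.mem_append, List.mem_singleton] at hz'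
        rcases hz' with h | h
        · exact hz z h
        · rw [h]; exact hy) (by simp; omega)
      rw [List.map_append, List.prod_append] at this
      simpa using this
    exact this hv

theorem nilrad_facts [FiniteDimensional ℂ A] (br : Bil A) (hL : IsLeibniz br)
    (hs : IsSolvableSub br (⊤ : Submodule ℂ A)) (N : Submodule ℂ A) (hN : IsNilradical br N) :
    (∀ x y, br x y ∈ N) ∧ ∀ x, IsNilpotent (br.flip x : Module.End ℂ A) → x ∈ N := by
  obtain ⟨χ, h1, h2, h3⟩ := triangularize br hs (finrank ℂ A) A rfl br.flip (by
    intro x y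
    ext z
    have := hL z x y
    simp only [LinearMap.flip_apply, LinearMap.sub_apply, Module.End.mul_apply]
    rw [this]; abel)
  have hJ : (⨅ i, LinearMap.ker (χ i)) ≤ N := by
    refine hN.2.2 _ ⟨le_top, ?_⟩ ⟨finrank ℂ A, ?_⟩
    · intro x _ y _
      simp only [Submodule.mem_iInf, LinearMap.mem_ker]
      exact ⟨fun i => h1 i _ _, fun i => h1 i _ _⟩
    · rw [eq_bot_iff]
      intro v hv
      have := lcs_prod_eq_zero br (⨅ i, LinearMap.ker (χ i)) (finrank ℂ A) (by
        intro zs hz hl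
        exact h3 zs (fun z hz' i => by
          have := hz z hz'
          simp only [Submodule.mem_iInf, LinearMap.mem_ker] at this
          exact this i) hl) _ v hv [] (by simp) (by simp)
      simpa using this
  refine ⟨fun x y => hJ ?_, fun x hx => hJ ?_⟩
  · simp only [Submodule.mem_iInf, LinearMap.mem_ker]
    exact fun i => h1 i _ _
  · simp only [Submodule.mem_iInf, LinearMap.mem_ker]
    intro i
    obtain ⟨n, hn⟩ := hx
    obtain ⟨v, hv⟩ := (h2 i x).exists_hasEigenvector
    have h4 := hv.pow_apply n
    rw [hn] at h4
    have h5 : (χ i x) ^ n = 0 := by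
      by_contra hne
      exact (smul_ne_zero hne hv.2) h4.symm
    exact eq_zero_of_pow_eq_zero h5

/-- The algebra `A` contains `V` as its nilradical, with right action `ρ`. -/
structure IsExt (br0 : Bil V) (br : Bil A) (φ : V →ₗ[ℂ] A) (ρ : A →ₗ[ℂ] Module.End ℂ V) :
    Prop where
  leib0 : IsLeibniz br0
  nil0 : IsNilpotentSub br0 (⊤ : Submodule ℂ V)
  leib : IsLeibniz br
  solv : IsSolvableSub br (⊤ : Submodule ℂ A)
  inj : Function.Injective φ
  hom : ∀ a b, φ (br0 a b) = br (φ a) (φ b)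
  act : ∀ x n, φ (ρ x n) = br (φ n) x
  brN : ∀ x y, br x y ∈ LinearMap.range φ
  nilN : ∀ x, IsNilpotent (br.flip x : Module.End ℂ A) → x ∈ LinearMap.range φ
  dim : finrank ℂ A = finrank ℂ V + finrank ℂ (V ⧸ sqr br0 (⊤ : Submodule ℂ V))

variable {br0 : Bil V} {br : Bil A} {φ : V →ₗ[ℂ] A} {ρ : A →ₗ[ℂ] Module.End ℂ V}

theorem IsExt.der (E : IsExt br0 br φ ρ) (x : A) : IsDer br0 (ρ x) := by
  intro a b
  apply E.inj
  rw [map_add, E.act, E.hom, E.hom, E.hom, E.act, E.act, E.leib]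

theorem IsExt.rep (E : IsExt br0 br φ ρ) : IsRightRep br ρ := by
  intro x y
  ext n
  apply E.inj
  have := E.leib (φ n) x y
  simp only [LinearMap.sub_apply, Module.End.mul_apply, map_sub, E.act]
  rw [this]; abel

theorem IsExt.nil (E : IsExt br0 br φ ρ) (x : A) (h : IsNilpotent (ρ x)) :
    x ∈ LinearMap.range φ := by
  apply E.nilN
  obtain ⟨n, hn⟩ := h
  refine ⟨n + 1, ?_⟩
  ext v
  obtain ⟨w, hw⟩ := E.brN v x
  have key : ∀ m, ((br.flip x : Module.End ℂ A) ^ m) (φ w) = φ ((ρ x ^ m) w) := by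
    intro m
    induction m with
    | zero => rfl
    | succ m ih =>
      rw [pow_succ', pow_succ', Module.End.mul_apply, ih, Module.End.mul_apply, E.act]
      rfl
  rw [pow_succ, Module.End.mul_apply, LinearMap.flip_apply, ← hw, key, hn]
  simp

/-- The action on the abelianization. -/
theorem IsExt.exists_bar (E : IsExt br0 br φ ρ) :
    ∃ ρ' : A →ₗ[ℂ] Module.End ℂ (V ⧸ sqr br0 (⊤ : Submodule ℂ V)),
      ∀ x n, ρ' x ((sqr br0 ⊤).mkQ n) = (sqr br0 ⊤).mkQ (ρ x n) := by
  refine ⟨{ toFun := fun x => (sqr br0 ⊤).mapQ (sqr br0 ⊤) (ρ x) (fun y hy => der_sqr (E.der x) hy)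
            map_add' := ?_, map_smul' := ?_ }, ?_⟩
  · intro x y
    ext n
    simp
  · intro c x
    ext n
    simp
  · intro x n
    rfl

theorem IsExt.nil_of_bar [FiniteDimensional ℂ V] (E : IsExt br0 br φ ρ) (x : A) (n : ℕ)
    (h : ∀ v, (ρ x ^ n) v ∈ sqr br0 (⊤ : Submodule ℂ V)) : x ∈ LinearMap.range φ := by
  apply E.nil
  have htop : (ρ x).maxGenEigenspace 0 = ⊤ := by
    refine eq_top_of_sup_sqr br0 E.leib0 E.nil0 _ ?_ ?_
    · intro a ha b hb
      have := maxGen_mulGraded (E.der x) 0 0 a ha b hb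
      rwa [add_zero] at this
    · rw [eq_top_iff]
      intro y _
      obtain ⟨z, hz, hz'⟩ := lift_maxGen (ρ x) (sqr br0 ⊤) (fun a ha => der_sqr (E.der x) ha) 0 n y
        (by simpa using h y)
      rw [← add_sub_cancel z y]
      exact Submodule.add_mem_sup hz hz'
  refine ⟨finrank ℂ V, ?_⟩
  ext v
  have hv : v ∈ (ρ x).maxGenEigenspace 0 := by rw [htop]; trivial
  rw [Module.End.maxGenEigenspace_eq_genEigenspace_finrank, Module.End.mem_genEigenspace_nat] at hv
  simpa using hv

theorem IsExt.weights [FiniteDimensional ℂ V] [FiniteDimensional ℂ A] (E : IsExt br0 br φ ρ)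
    {ρ' : A →ₗ[ℂ] Module.End ℂ (V ⧸ sqr br0 (⊤ : Submodule ℂ V))}
    (hρ' : ∀ x n, ρ' x ((sqr br0 ⊤).mkQ n) = (sqr br0 ⊤).mkQ (ρ x n)) {k : ℕ}
    (hk : finrank ℂ (V ⧸ sqr br0 (⊤ : Submodule ℂ V)) = k) (c : Fin k → ℂ) :
    ∃ x : A, ∀ i, (ρ' x).HasEigenvalue (c i) := by
  obtain ⟨χ, h1, h2, h3⟩ := triangularize br E.solv k _ hk ρ' (by
    intro x y
    ext n
    simp only [LinearMap.comp_apply, LinearMap.sub_apply, Module.End.mul_apply, hρ', E.rep x y,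
      map_sub])
  let X : A →ₗ[ℂ] (Fin k → ℂ) := LinearMap.pi χ
  have hker : LinearMap.ker X ≤ LinearMap.range φ := by
    intro x hx
    have hx' : ∀ i, χ i x = 0 := fun i => congrFun hx i
    apply E.nil_of_bar x k
    have h4 := h3 (List.replicate k x) (by
      intro z hz i
      rw [List.eq_of_mem_replicate hz]; exact hx' i) (by simp)
    rw [List.map_replicate, List.prod_replicate] at h4
    intro v
    have key : ∀ m, (ρ' x ^ m) ((sqr br0 ⊤).mkQ v) = (sqr br0 ⊤).mkQ ((ρ x ^ m) v) := by
      intro m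
      induction m with
      | zero => rfl
      | succ m ih =>
        rw [pow_succ', pow_succ', Module.End.mul_apply, ih, Module.End.mul_apply, hρ']
    have h5 := key k
    rw [h4] at h5
    rw [← Submodule.ker_mkQ (sqr br0 ⊤), LinearMap.mem_ker, ← h5]
    rfl
  have hsurj : LinearMap.range X = ⊤ := by
    apply Submodule.eq_top_of_finrank_eq
    have h4 := LinearMap.finrank_range_add_finrank_ker X
    have h5 := Submodule.finrank_mono hker
    have h6 := LinearMap.finrank_range_of_inj E.inj
    have h7 := E.dim
    have h8 := Submodule.finrank_le (LinearMap.range X)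
    rw [Module.finrank_fin_fun] at h8 ⊢
    omega
  obtain ⟨x, hx⟩ := LinearMap.range_eq_top.1 hsurj c
  refine ⟨x, fun i => ?_⟩
  have := h2 i x
  have h4 : χ i x = c i := congrFun hx i
  rwa [h4] at this

end Ext

section Ext2
variable {V : Type u} [AddCommGroup V] [Module ℂ V]
variable {A : Type v} [AddCommGroup A] [Module ℂ A]
variable {br0 : Bil V} {br : Bil A} {φ : V →ₗ[ℂ] A} {ρ : A →ₗ[ℂ] Module.End ℂ V}

theorem IsExt.regular [FiniteDimensional ℂ V] [FiniteDimensional ℂ A] (E : IsExt br0 br φ ρ)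
    {k : ℕ} (hk : finrank ℂ (V ⧸ sqr br0 (⊤ : Submodule ℂ V)) = k) :
    ∃ (e : Fin k → V) (lam : Fin k → V →ₗ[ℂ] ℂ) (x : A) (c : Fin k → ℂ),
      Generates br0 e ∧ (∀ i a b, lam i (br0 a b) = 0) ∧
      (∀ i j, lam i (e j) = if i = j then 1 else 0) ∧
      (∀ i, e i ∈ (ρ x).maxGenEigenspace (c i)) ∧
      (∀ i, ∀ y ∈ (ρ x).maxGenEigenspace (c i), y = lam i y • e i) ∧
      (∀ y, ρ x y = 0 → y = 0) := by
  obtain ⟨ρ', hρ'⟩ := E.exists_bar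
  obtain ⟨x, hx⟩ := E.weights hρ' hk (fun i => ((k + 1 + i : ℕ) : ℂ))
  choose w hw using fun i => (hx i).exists_hasEigenvector
  have hinj : Function.Injective (fun i : Fin k => ((k + 1 + i : ℕ) : ℂ)) := by
    intro i j hij
    have : k + 1 + (i : ℕ) = k + 1 + j := Nat.cast_injective (R := ℂ) hij
    exact Fin.ext (by omega)
  have hli : LinearIndependent ℂ w :=
    Module.End.eigenvectors_linearIndependent' (ρ' x) _ hinj w hw
  have hsp : Submodule.span ℂ (Set.range w) = ⊤ :=
    hli.span_eq_top_of_card_eq_finrank' (by simp [hk])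
  let b : Basis (Fin k) ℂ _ := Basis.mk hli hsp.ge
  have hb : ∀ i, b i = w i := fun i => Basis.mk_apply _ _ i
  have hlift : ∀ i : Fin k, ∃ z ∈ (ρ x).maxGenEigenspace ((k + 1 + i : ℕ) : ℂ),
      (sqr br0 ⊤).mkQ z = w i := by
    intro i
    obtain ⟨v, hv⟩ := Submodule.mkQ_surjective (sqr br0 ⊤) (w i)
    obtain ⟨z, hz, hz'⟩ := lift_maxGen (ρ x) (sqr br0 ⊤) (fun a ha => der_sqr (E.der x) ha)
      ((k + 1 + i : ℕ) : ℂ) 1 v (by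
        rw [← Submodule.ker_mkQ (sqr br0 ⊤), LinearMap.mem_ker]
        have := (hw i).apply_eq_smul
        rw [pow_one, LinearMap.sub_apply, map_sub, ← hρ', hv, this]
        simp [hv])
    refine ⟨z, hz, ?_⟩
    rw [← Submodule.ker_mkQ (sqr br0 ⊤), LinearMap.mem_ker, map_sub, sub_eq_zero] at hz'
    rw [← hz', hv]
  choose e he he' using hlift
  let lam : Fin k → V →ₗ[ℂ] ℂ := fun i => (b.coord i).comp (sqr br0 ⊤).mkQ
  have hsub : ∀ y, y - ∑ i, lam i y • e i ∈ sqr br0 ⊤ := by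
    intro y
    rw [← Submodule.ker_mkQ (sqr br0 ⊤), LinearMap.mem_ker, map_sub, sub_eq_zero, map_sum]
    simp only [map_smul, he', ← hb]
    exact (b.sum_repr _).symm
  have hgen : Generates br0 e := by
    refine generates_of_sup_sqr br0 E.leib0 E.nil0 e ?_
    rw [eq_top_iff]
    intro y _
    rw [← add_sub_cancel (∑ i, lam i y • e i) y]
    refine Submodule.add_mem_sup ?_ (hsub y)
    exact Submodule.sum_mem _ fun i _ => Submodule.smul_mem _ _ (Submodule.subset_span ⟨i, rfl⟩)
  have hgr := maxGen_mulGraded (E.der x)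
  have hgeq : geq (ρ x).maxGenEigenspace (k + 1) = ⊤ :=
    geq_eq_top hgr hgen (k + 1) fun i => ⟨k + 1 + i, by omega, he i⟩
  have hsq := sqr_le_geq hgr (k + 1) hgeq
  have hind := Module.End.independent_maxGenEigenspace (ρ x)
  have hle : ∀ p q : ℕ, q < p → geq (ρ x).maxGenEigenspace p ≤
      ⨆ ν, ⨆ (_ : ν ≠ (q : ℂ)), (ρ x).maxGenEigenspace ν := by
    intro p q hpq
    refine iSup_le fun n => ?_
    exact le_iSup₂_of_le (f := fun ν (_ : ν ≠ (q : ℂ)) => (ρ x).maxGenEigenspace ν)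
      ((p + n : ℕ) : ℂ) (by
        intro h
        have : p + n = q := by exact_mod_cast h
        omega) le_rfl
  refine ⟨e, lam, x, fun i => ((k + 1 + i : ℕ) : ℂ), hgen, ?_, ?_, he, ?_, ?_⟩
  · intro i a a'
    have : (sqr br0 ⊤).mkQ (br0 a a') = 0 := by
      rw [← LinearMap.mem_ker, Submodule.ker_mkQ]
      exact br_mem_sqr br0 a a'
    simp only [lam, LinearMap.comp_apply]
    rw [this, map_zero]
  · intro i j
    simp only [lam, LinearMap.comp_apply, he', ← hb, Basis.coord_apply, Basis.repr_self]
    rw [Finsupp.single_apply]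
    by_cases h : i = j
    · simp [h]
    · simp [h, Ne.symm h]
  · intro i y hy
    have hd := hind ((k + 1 + i : ℕ) : ℂ)
    rw [← sub_eq_zero]
    refine Submodule.disjoint_def.1 hd _ (Submodule.sub_mem _ hy (Submodule.smul_mem _ _ (he i))) ?_
    have h1 : y - lam i y • e i =
        (y - ∑ j, lam j y • e j) + ∑ j ∈ Finset.univ.erase i, lam j y • e j := by
      rw [← Finset.add_sum_erase _ _ (Finset.mem_univ i)]
      abel
    rw [h1]
    refine Submodule.add_mem _ (hle _ _ (by omega) (hsq (hsub y))) ?_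
    refine Submodule.sum_mem _ fun j hj => Submodule.smul_mem _ _ ?_
    have hne : ((k + 1 + j : ℕ) : ℂ) ≠ ((k + 1 + i : ℕ) : ℂ) := by
      intro h
      exact (Finset.ne_of_mem_erase hj) (hinj h)
    exact le_iSup₂_of_le (f := fun ν (_ : ν ≠ ((k + 1 + i : ℕ) : ℂ)) => (ρ x).maxGenEigenspace ν)
      _ hne le_rfl (he j)
  · intro y hy
    have hd := hind ((0 : ℕ) : ℂ)
    refine Submodule.disjoint_def.1 hd y ?_ (hle (k + 1) 0 (by omega) (by rw [hgeq]; trivial))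
    rw [Module.End.mem_maxGenEigenspace]
    exact ⟨1, by simp [hy]⟩

theorem IsExt.rho_phi (E : IsExt br0 br φ ρ) (n m : V) : ρ (φ n) m = br0 m n := by
  apply E.inj
  rw [E.act, E.hom]

theorem IsExt.exists_left (E : IsExt br0 br φ ρ) (h : A) :
    ∃ l : Module.End ℂ V, ∀ n, φ (l n) = br h (φ n) := by
  let ψ := LinearEquiv.ofInjective φ E.inj
  refine ⟨ψ.symm.toLinearMap.comp ((br h).restrict (p := LinearMap.range φ) (q := LinearMap.range φ)
    (fun y _ => E.brN h y) |>.comp ψ.toLinearMap), ?_⟩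
  intro n
  have : ∀ z, φ (ψ.symm z) = z := fun z => by
    rw [← LinearEquiv.ofInjective_apply (h := E.inj), LinearEquiv.apply_symm_apply]
  simp only [LinearMap.comp_apply, LinearEquiv.coe_coe, this]
  rfl

theorem IsExt.torus [FiniteDimensional ℂ V] [FiniteDimensional ℂ A] (E : IsExt br0 br φ ρ)
    {k : ℕ} (hk : finrank ℂ (V ⧸ sqr br0 (⊤ : Submodule ℂ V)) = k) :
    ∃ (e : Fin k → V) (lam : Fin k → V →ₗ[ℂ] ℂ) (h : Fin k → A),
      IsSys br0 e lam (fun j => ρ (h j)) ∧ (∀ i j, br (h i) (h j) = 0) ∧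
      (∀ i j, ∃ γ : ℂ, br (h i) (φ (e j)) = γ • φ (e j)) := by
  obtain ⟨e, lam, x, c, hgen, hlbr, hle, he, hmax, hker⟩ := E.regular hk
  have hcomm : ∀ h, br h x = 0 → ∀ i, ρ h (e i) = lam i (ρ h (e i)) • e i := by
    intro h hh i
    refine hmax i _ ?_
    refine Module.End.mapsTo_maxGenEigenspace_of_comm (f := ρ x) (g := ρ h) ?_ (c i) (he i)
    have := E.rep h x
    rw [hh, map_zero] at this
    exact (sub_eq_zero.1 this.symm)
  have hHN : ∀ h, br h x = 0 → h ∈ LinearMap.range φ → h = 0 := by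
    rintro _ hh ⟨n, rfl⟩
    rw [hker n, map_zero]
    apply E.inj
    rw [E.act, hh, map_zero]
  let α : A →ₗ[ℂ] (Fin k → ℂ) := LinearMap.pi fun i =>
    (lam i).comp ((LinearMap.applyₗ (e i)).comp ρ)
  have hα : ∀ h i, α h i = lam i (ρ h (e i)) := fun h i => rfl
  let H : Submodule ℂ A := LinearMap.ker (br.flip x)
  have hH : ∀ h, h ∈ H ↔ br h x = 0 := fun h => Iff.rfl
  let αH : H →ₗ[ℂ] (Fin k → ℂ) := α.comp H.subtype
  have hinj : Function.Injective αH := by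
    rw [← LinearMap.ker_eq_bot, LinearMap.ker_eq_bot']
    rintro ⟨h, hh⟩ h0
    have h1 : ρ h = 0 := by
      refine hgen.der_ext (E.der h) (by intro a b; simp) fun i => ?_
      rw [hcomm h hh i, ← hα]
      have : α h i = 0 := congrFun h0 i
      rw [this]; simp
    have h2 := hHN h hh (E.nil h (by rw [h1]; exact IsNilpotent.zero))
    exact Subtype.ext h2
  have hdim : k ≤ finrank ℂ H := by
    have h1 := LinearMap.finrank_range_add_finrank_ker (br.flip x)
    have h2 : LinearMap.range (br.flip x) ≤ LinearMap.range φ := by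
      rintro _ ⟨y, rfl⟩
      exact E.brN y x
    have h3 := Submodule.finrank_mono h2
    rw [LinearMap.finrank_range_of_inj E.inj] at h3
    have h4 := E.dim
    change _ + finrank ℂ H = _ at h1
    omega
  have hdim2 : finrank ℂ H = finrank ℂ (Fin k → ℂ) := by
    have := LinearMap.finrank_le_finrank_of_injective hinj
    rw [Module.finrank_fin_fun] at this ⊢
    omega
  have hsurj : Function.Surjective αH :=
    (LinearMap.injective_iff_surjective_of_finrank_eq_finrank hdim2).1 hinj
  choose hh hhα using fun j : Fin k => hsurj (Pi.single j 1)
  have hhx : ∀ j, br (hh j : A) x = 0 := fun j => (hh j).2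
  have hval : ∀ j i, lam i (ρ (hh j) (e i)) = if j = i then 1 else 0 := by
    intro j i
    have := congrFun (hhα j) i
    rw [Pi.single_apply] at this
    rw [← hα]
    refine this.trans ?_
    simp [eq_comm]
  refine ⟨e, lam, fun j => hh j, ⟨hgen, hlbr, hle, fun j => E.der _, ?_⟩, ?_, ?_⟩
  · intro i j
    rw [hcomm _ (hhx i) j, hval]
    by_cases h : i = j
    · simp [h]
    · simp [h]
  · intro i j
    refine hHN _ ?_ (E.brN _ _)
    rw [E.leib, hhx, hhx]
    simp
  · intro i j
    obtain ⟨l, hl⟩ := E.exists_left (hh i : A)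
    refine ⟨lam j (l (e j)), ?_⟩
    rw [← hl, ← map_smul, ← hmax j (l (e j))]
    refine Module.End.mapsTo_maxGenEigenspace_of_comm (f := ρ x) (g := l) ?_ (c j) (he j)
    ext n
    apply E.inj
    rw [Module.End.mul_apply, Module.End.mul_apply, E.act, hl, hl, E.act, E.leib, hhx]
    simp

theorem IsExt.left_values (E : IsExt br0 br φ ρ) {k : ℕ} {e : Fin k → V}
    {lam : Fin k → V →ₗ[ℂ] ℂ} {h : Fin k → A} (S : IsSys br0 e lam (fun j => ρ (h j)))
    (hleft : ∀ i j, ∃ γ : ℂ, br (h i) (φ (e j)) = γ • φ (e j))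
    (hc : ∀ j, (∃ n, br0 n (e j) ≠ 0) ∨ ∃ n, br0 (e j) n ≠ 0) (i j : Fin k) :
    ((∃ n, br0 n (e j) ≠ 0) → br (h i) (φ (e j)) = - if i = j then φ (e j) else 0) ∧
    ((∀ n, br0 n (e j) = 0) → br (h i) (φ (e j)) = 0) := by
  have hanti : ∀ a y z, br a (br y z) = - br a (br z y) := by
    intro a y z
    have h1 := E.leib a y z
    have h2 := E.leib a z y
    rw [h1] at h2
    have h3 : br a (br y z) + br a (br z y) = 0 := by
      have := sub_eq_zero.2 h2
      rw [← neg_eq_zero, ← this]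
      abel
    exact eq_neg_of_add_eq_zero_left h3
  have hmul : ∀ a y z, br a (br y z) = br (br a y) z - br (br a z) y := by
    intro a y z
    rw [E.leib a y z]; abel
  obtain ⟨γ, hγ⟩ := hleft i j
  have hr : br (φ (e j)) (h i) = (if i = j then (1 : ℂ) else 0) • φ (e j) := by
    rw [← E.act, S.D_e]
    by_cases hij : i = j
    · simp [hij]
    · simp [hij]
  constructor
  · rintro ⟨n, hn⟩
    have h1 := hanti (φ n) (h i) (φ (e j))
    rw [hγ, hr, map_smul, map_smul, ← E.hom, ← neg_smul] at h1
    have h2 : γ = -(if i = j then (1 : ℂ) else 0) := by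
      have hne : φ (br0 n (e j)) ≠ 0 := fun h0 => hn (E.inj (by rw [h0, map_zero]))
      exact smul_left_injective ℂ hne h1
    rw [hγ, h2]
    by_cases hij : i = j
    · simp [hij]
    · simp [hij]
  · intro hn
    have h1 : ∃ i', br0 (e j) (e i') ≠ 0 := by
      by_contra hcon
      push Not at hcon
      have htop := S.gen (LinearMap.ker (br0 (e j))) hcon (by
        intro y hy z hz
        rw [LinearMap.mem_ker] at *
        have := E.leib0 (e j) y z
        rw [hy, hz] at this
        simpa using this.symm)
      rcases hc j with ⟨n, hn'⟩ | ⟨n, hn'⟩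
      · exact hn' (hn n)
      · apply hn'
        rw [← LinearMap.mem_ker, htop]
        trivial
    obtain ⟨i', hi'⟩ := h1
    obtain ⟨γ', hγ'⟩ := hleft i i'
    have h2 := hanti (h i) (φ (e j)) (φ (e i'))
    rw [← E.hom (e i'), hn, map_zero, map_zero, neg_zero, hmul, hγ, hγ', map_smul, map_smul,
      LinearMap.smul_apply, LinearMap.smul_apply, ← E.hom, ← E.hom, hn, map_zero, smul_zero,
      sub_zero] at h2
    have hne : φ (br0 (e j) (e i')) ≠ 0 := fun h0 => hi' (E.inj (by rw [h0, map_zero]))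
    rw [hγ, (smul_eq_zero.1 h2).resolve_right hne, zero_smul]

end Ext2

section Glue
variable {V : Type u} [AddCommGroup V] [Module ℂ V]
variable {A : Type v} [AddCommGroup A] [Module ℂ A]
variable {B : Type w} [AddCommGroup B] [Module ℂ B]

theorem noncentral (br0 : Bil V) (s : ℕ) (Ns : Fin s → Submodule ℂ V)
    (hideal : ∀ t, IsIdeal br0 (Ns t))
    (hindep : iSupIndep Ns) (hsup : (⨆ t, Ns t) = (⊤ : Submodule ℂ V))
    (hnonsplit : ∀ t, ¬ IsSplitIn br0 (Ns t))
    (hnonab : ∀ t, ¬ IsAbelianIn br0 (Ns t)) (l : V →ₗ[ℂ] ℂ) (hl : ∀ x y, l (br0 x y) = 0)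
    (e : V) (he : l e ≠ 0) : (∃ n, br0 n e ≠ 0) ∨ ∃ n, br0 e n ≠ 0 := by
  by_contra hcon
  push Not at hcon
  obtain ⟨hc1, hc2⟩ := hcon
  have hmem : e ∈ ⨆ t, Ns t := by rw [hsup]; trivial
  obtain ⟨z, hz, hze⟩ := (Submodule.mem_iSup_iff_exists_finsupp Ns e).1 hmem
  rw [Finsupp.sum] at hze
  have h1 : ∃ t ∈ z.support, l (z t) ≠ 0 := by
    by_contra h
    push Not at h
    apply he
    rw [← hze, map_sum]
    exact Finset.sum_eq_zero h
  obtain ⟨t, hts, ht⟩ := h1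
  have hdis : ∀ u ≠ t, ∀ y ∈ Ns u, y ∈ Ns t → y = 0 := fun u hu y hy hy' =>
    Submodule.disjoint_def.1 (hindep.pairwiseDisjoint hu) y hy hy'
  have hr : ∀ n ∈ Ns t, br0 (z t) n = 0 := by
    intro n hn
    have h2 := hc2 n
    rw [← hze, map_sum, LinearMap.sum_apply, Finset.sum_eq_single t] at h2
    · exact h2
    · intro u _ hu
      exact hdis u hu _ ((hideal u).2 _ (hz u) n trivial).1 ((hideal t).2 _ hn _ trivial).2
    · intro h; exact absurd hts h
  have hlft : ∀ n ∈ Ns t, br0 n (z t) = 0 := by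
    intro n hn
    have h2 := hc1 n
    rw [← hze, map_sum, Finset.sum_eq_single t] at h2
    · exact h2
    · intro u _ hu
      exact hdis u hu _ ((hideal u).2 _ (hz u) n trivial).2 ((hideal t).2 _ hn _ trivial).1
    · intro h; exact absurd hts h
  have hsupA : Submodule.span ℂ {z t} ⊔ (Ns t ⊓ LinearMap.ker l) = Ns t := by
    apply le_antisymm
    · refine sup_le ?_ inf_le_left
      rw [Submodule.span_singleton_le_iff_mem]
      exact hz t
    · intro x hx
      rw [← add_sub_cancel ((l x / l (z t)) • z t) x]
      refine Submodule.add_mem_sup (Submodule.smul_mem _ _ (Submodule.mem_span_singleton_self _)) ?_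
      refine ⟨Submodule.sub_mem _ hx (Submodule.smul_mem _ _ (hz t)), ?_⟩
      change l _ = 0
      rw [map_sub, map_smul, smul_eq_mul, div_mul_cancel₀ _ ht, sub_self]
  have hzero : ∀ x ∈ Submodule.span ℂ {z t}, ∀ y ∈ Ns t, br0 x y = 0 ∧ br0 y x = 0 := by
    intro x hx y hy
    obtain ⟨c, rfl⟩ := Submodule.mem_span_singleton.1 hx
    rw [map_smul, map_smul, LinearMap.smul_apply, hr y hy, hlft y hy]
    simp
  by_cases hB : Ns t ⊓ LinearMap.ker l = ⊥
  · rw [hB, sup_bot_eq] at hsupA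
    apply hnonab t
    intro x hx y hy
    rw [← hsupA] at hx
    exact (hzero x hx y hy).1
  · apply hnonsplit t
    refine ⟨Submodule.span ℂ {z t}, Ns t ⊓ LinearMap.ker l, ⟨?_, ?_⟩, ⟨inf_le_left, ?_⟩, ?_, hB, ?_,
      hsupA⟩
    · rw [Submodule.span_singleton_le_iff_mem]
      exact hz t
    · intro x hx y hy
      rw [(hzero x hx y hy).1, (hzero x hx y hy).2]
      exact ⟨Submodule.zero_mem _, Submodule.zero_mem _⟩
    · intro x hx y hy
      have := (hideal t).2 x hx.1 y trivial
      exact ⟨⟨this.1, hl _ _⟩, ⟨this.2, hl _ _⟩⟩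
    · intro h
      rw [Submodule.span_singleton_eq_bot] at h
      rw [h, map_zero] at ht
      exact ht rfl
    · rw [eq_bot_iff]
      rintro x ⟨hx, _, hx'⟩
      obtain ⟨c, rfl⟩ := Submodule.mem_span_singleton.1 hx
      have h3 : l (c • z t) = 0 := hx'
      rw [map_smul, smul_eq_mul, mul_eq_zero] at h3
      rw [h3.resolve_right ht, zero_smul]
      exact Submodule.zero_mem _

theorem dimModSq_top (br0 : Bil V) :
    dimModSq br0 (⊤ : Submodule ℂ V) = finrank ℂ (V ⧸ sqr br0 (⊤ : Submodule ℂ V)) := by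
  refine LinearEquiv.finrank_eq (Submodule.Quotient.equiv _ _ Submodule.topEquiv ?_)
  ext y
  constructor
  · rintro ⟨x, hx, rfl⟩
    exact hx
  · intro hy
    exact ⟨⟨y, trivial⟩, hy, rfl⟩

theorem exists_isExt [FiniteDimensional ℂ A] (br0 : Bil V) (h0 : IsLeibniz br0)
    (hnil : IsNilpotentSub br0 (⊤ : Submodule ℂ V)) (br : Bil A) (h1 : IsLeibniz br)
    (hs : IsSolvableSub br (⊤ : Submodule ℂ A)) (N : Submodule ℂ A) (hN : IsNilradical br N)
    (hiso : SubAlgIso br0 ⊤ br N)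
    (hd : finrank ℂ A = finrank ℂ V + dimModSq br0 (⊤ : Submodule ℂ V)) :
    ∃ (φ : V →ₗ[ℂ] A) (ρ : A →ₗ[ℂ] Module.End ℂ V), IsExt br0 br φ ρ := by
  obtain ⟨φ0, hinj, hrange, hhom⟩ := hiso
  let φ : V →ₗ[ℂ] A := φ0.comp Submodule.topEquiv.symm.toLinearMap
  have hφinj : Function.Injective φ := hinj.comp Submodule.topEquiv.symm.injective
  have hφhom : ∀ a b, φ (br0 a b) = br (φ a) (φ b) := fun a b => hhom _ _ _ rfl
  have hφN : LinearMap.range φ = N := by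
    ext y
    rw [← SetLike.mem_coe (p := N), ← hrange]
    constructor
    · rintro ⟨n, rfl⟩
      exact ⟨_, rfl⟩
    · rintro ⟨n, rfl⟩
      exact ⟨n, rfl⟩
  obtain ⟨hb, hni⟩ := nilrad_facts br h1 hs N hN
  rw [← hφN] at hb hni
  obtain ⟨p, hp⟩ := LinearMap.exists_leftInverse_of_injective φ (LinearMap.ker_eq_bot.2 hφinj)
  have hp' : ∀ y ∈ LinearMap.range φ, φ (p y) = y := by
    rintro _ ⟨n, rfl⟩
    have : p (φ n) = n := LinearMap.congr_fun hp n
    rw [this]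
  let ρ : A →ₗ[ℂ] Module.End ℂ V := LinearMap.mk₂ ℂ (fun x n => p (br (φ n) x))
    (by intro a b c; simp) (by intro a b c; simp) (by intro a b c; simp) (by intro a b c; simp)
  refine ⟨φ, ρ, h0, hnil, h1, hs, hφinj, hφhom, ?_, hb, hni, ?_⟩
  · intro x n
    exact hp' _ (hb _ _)
  · rw [hd, dimModSq_top]

variable {br0 : Bil V} {br1 : Bil A} {φ1 : V →ₗ[ℂ] A} {ρ1 : A →ₗ[ℂ] Module.End ℂ V}
  {br2 : Bil B} {φ2 : V →ₗ[ℂ] B} {ρ2 : B →ₗ[ℂ] Module.End ℂ V}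

theorem IsExt.split [FiniteDimensional ℂ V] [FiniteDimensional ℂ A] (E : IsExt br0 br1 φ1 ρ1)
    {k : ℕ} (hk : finrank ℂ (V ⧸ sqr br0 (⊤ : Submodule ℂ V)) = k) {e : Fin k → V}
    {lam : Fin k → V →ₗ[ℂ] ℂ} {h : Fin k → A} (S : IsSys br0 e lam (fun j => ρ1 (h j))) :
    ∃ Ψ : (V × (Fin k → ℂ)) ≃ₗ[ℂ] A, ∀ n a, Ψ (n, a) = φ1 n + ∑ j, a j • h j := by
  let f : (V × (Fin k → ℂ)) →ₗ[ℂ] A :=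
    LinearMap.coprod φ1 (Fintype.linearCombination ℂ h)
  have hf : ∀ n a, f (n, a) = φ1 n + ∑ j, a j • h j := by
    intro n a
    simp [f, Fintype.linearCombination_apply]
  have hinj : Function.Injective f := by
    rw [← LinearMap.ker_eq_bot, LinearMap.ker_eq_bot']
    rintro ⟨n, a⟩ h0
    rw [hf] at h0
    have ha : a = 0 := by
      ext i
      have h1 : lam i (ρ1 (φ1 n + ∑ j, a j • h j) (e i)) = 0 := by
        rw [h0]; simp
      have h2 : ∀ j, ρ1 (h j) (e i) = if j = i then e i else 0 := fun j => S.D_e j i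
      rw [map_add, map_sum, LinearMap.add_apply, E.rho_phi, map_add, S.lam_br, zero_add,
        LinearMap.sum_apply] at h1
      simp only [map_smul, LinearMap.smul_apply, h2] at h1
      simpa [S.lam_e] using h1
    subst ha
    have hn : n = 0 := by
      apply E.inj
      simpa using h0
    rw [hn]; rfl
  have hfr : finrank ℂ (V × (Fin k → ℂ)) = finrank ℂ A := by
    rw [Module.finrank_prod, Module.finrank_fin_fun, E.dim, hk]
  exact ⟨LinearEquiv.ofInjectiveOfFinrankEq f hinj hfr, hf⟩

theorem glue (E1 : IsExt br0 br1 φ1 ρ1) (E2 : IsExt br0 br2 φ2 ρ2) {k : ℕ} {e : Fin k → V}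
    (he : Generates br0 e) (g : V ≃ₗ[ℂ] V) (hg : IsAut br0 g) (h : Fin k → A) (h' : Fin k → B)
    (Ψ1 : (V × (Fin k → ℂ)) ≃ₗ[ℂ] A) (hΨ1 : ∀ n a, Ψ1 (n, a) = φ1 n + ∑ j, a j • h j)
    (Ψ2 : (V × (Fin k → ℂ)) ≃ₗ[ℂ] B) (hΨ2 : ∀ n a, Ψ2 (n, a) = φ2 n + ∑ j, a j • h' j)
    (hD1 : ∀ i j, ρ1 (h i) (e j) = if i = j then e j else 0)
    (hD2 : ∀ i j, ρ2 (h' i) (g (e j)) = if i = j then g (e j) else 0)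
    (hh1 : ∀ i j, br1 (h i) (h j) = 0) (hh2 : ∀ i j, br2 (h' i) (h' j) = 0)
    (hl1 : ∀ i j, ((∃ n, br0 n (e j) ≠ 0) →
        br1 (h i) (φ1 (e j)) = - if i = j then φ1 (e j) else 0) ∧
      ((∀ n, br0 n (e j) = 0) → br1 (h i) (φ1 (e j)) = 0))
    (hl2 : ∀ i j, ((∃ n, br0 n (g (e j)) ≠ 0) →
        br2 (h' i) (φ2 (g (e j))) = - if i = j then φ2 (g (e j)) else 0) ∧
      ((∀ n, br0 n (g (e j)) = 0) → br2 (h' i) (φ2 (g (e j))) = 0)) :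
    AlgIso br1 br2 := by
  let Φ : A ≃ₗ[ℂ] B :=
    (Ψ1.symm.trans (LinearEquiv.prodCongr g (LinearEquiv.refl ℂ (Fin k → ℂ)))).trans Ψ2
  have hΦ : ∀ (n : V) (a : Fin k → ℂ), Φ (φ1 n + ∑ j, a j • h j) = φ2 (g n) + ∑ j, a j • h' j := by
    intro n a
    rw [← hΨ1, ← hΨ2]
    simp [Φ]
  have hΦn : ∀ n, Φ (φ1 n) = φ2 (g n) := by
    intro n
    simpa using hΦ n 0
  have hΦh : ∀ j, Φ (h j) = h' j := by
    intro j
    simpa [Pi.single_apply] using hΦ 0 (Pi.single j 1)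
  have hNH : ∀ n j, Φ (br1 (φ1 n) (h j)) = br2 (φ2 (g n)) (h' j) := by
    intro n j
    have htop := he (LinearMap.eqLocus (g.toLinearMap.comp (ρ1 (h j)))
      ((ρ2 (h' j)).comp g.toLinearMap)) (by
        intro i
        rw [LinearMap.mem_eqLocus]
        simp only [LinearMap.comp_apply, LinearEquiv.coe_coe, hD1, hD2]
        by_cases hij : j = i
        · simp [hij]
        · simp [hij]) (by
        intro x hx y hy
        rw [LinearMap.mem_eqLocus] at *
        simp only [LinearMap.comp_apply, LinearEquiv.coe_coe] at *
        rw [E1.der, hg, E2.der, map_add, hg, hg, hx, hy])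
    have hn : n ∈ LinearMap.eqLocus (g.toLinearMap.comp (ρ1 (h j)))
      ((ρ2 (h' j)).comp g.toLinearMap) := by rw [htop]; trivial
    rw [LinearMap.mem_eqLocus] at hn
    simp only [LinearMap.comp_apply, LinearEquiv.coe_coe] at hn
    rw [← E1.act, ← E2.act, hΦn, hn]
  have hHN : ∀ n j, Φ (br1 (h j) (φ1 n)) = br2 (h' j) (φ2 (g n)) := by
    intro n j
    obtain ⟨l1, hl1'⟩ := E1.exists_left (h j)
    obtain ⟨l2, hl2'⟩ := E2.exists_left (h' j)
    have hm1 : ∀ y z, l1 (br0 y z) = br0 (l1 y) z - br0 (l1 z) y := by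
      intro y z
      apply E1.inj
      rw [map_sub, hl1', E1.hom, E1.hom, E1.hom, hl1', hl1', E1.leib (h j) (φ1 y) (φ1 z)]
      abel
    have hm2 : ∀ y z, l2 (br0 y z) = br0 (l2 y) z - br0 (l2 z) y := by
      intro y z
      apply E2.inj
      rw [map_sub, hl2', E2.hom, E2.hom, E2.hom, hl2', hl2', E2.leib (h' j) (φ2 y) (φ2 z)]
      abel
    have htop := he (LinearMap.eqLocus (g.toLinearMap.comp l1) (l2.comp g.toLinearMap)) (by
        intro i
        rw [LinearMap.mem_eqLocus]
        simp only [LinearMap.comp_apply, LinearEquiv.coe_coe]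
        apply E2.inj
        rw [← hΦn, hl1', hl2']
        by_cases hann : ∀ n, br0 n (e i) = 0
        · rw [(hl1 j i).2 hann, (hl2 j i).2, map_zero]
          intro n
          have := hg (g.symm n) (e i)
          rw [LinearEquiv.apply_symm_apply] at this
          rw [← this, hann, map_zero]
        · push Not at hann
          obtain ⟨n, hn⟩ := hann
          rw [(hl1 j i).1 ⟨n, hn⟩, (hl2 j i).1 ⟨g n, ?_⟩, map_neg]
          · by_cases hij : j = i
            · simp [hij, hΦn]
            · simp [hij]
          · rw [← hg]
            intro h0
            exact hn (g.injective (by rw [h0, map_zero]))) (by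
        intro x hx y hy
        rw [LinearMap.mem_eqLocus] at *
        simp only [LinearMap.comp_apply, LinearEquiv.coe_coe] at *
        rw [hm1, hg, hm2, map_sub, hg, hg, hx, hy])
    have hn : n ∈ LinearMap.eqLocus (g.toLinearMap.comp l1) (l2.comp g.toLinearMap) := by
      rw [htop]; trivial
    rw [LinearMap.mem_eqLocus] at hn
    simp only [LinearMap.comp_apply, LinearEquiv.coe_coe] at hn
    rw [← hl1', ← hl2', hΦn, hn]
  refine ⟨Φ, fun x y => ?_⟩
  obtain ⟨⟨n, a⟩, rfl⟩ := Ψ1.surjective x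
  obtain ⟨⟨m, b⟩, rfl⟩ := Ψ1.surjective y
  rw [hΨ1, hΨ1, hΦ, hΦ]
  simp only [map_add, map_sum, map_smul, LinearMap.add_apply, LinearMap.sum_apply,
    LinearMap.smul_apply, hNH, hHN, hh1, hh2, map_zero, ← E1.hom, hΦn]
  rw [hg, E2.hom]

theorem glue_final [FiniteDimensional ℂ V] [FiniteDimensional ℂ A] [FiniteDimensional ℂ B]
    (E1 : IsExt br0 br1 φ1 ρ1) (E2 : IsExt br0 br2 φ2 ρ2)
    (hnc : ∀ (l : V →ₗ[ℂ] ℂ), (∀ x y, l (br0 x y) = 0) → ∀ e, l e ≠ 0 →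
      (∃ n, br0 n e ≠ 0) ∨ ∃ n, br0 e n ≠ 0) : AlgIso br1 br2 := by
  obtain ⟨k, hk⟩ : ∃ k, finrank ℂ (V ⧸ sqr br0 (⊤ : Submodule ℂ V)) = k := ⟨_, rfl⟩
  obtain ⟨e, lam, h, S1, hh1, hl1⟩ := E1.torus hk
  obtain ⟨f, lam', h', S2, hh2, hl2⟩ := E2.torus hk
  have hl1' := E1.left_values S1 hl1 fun j => hnc (lam j) (S1.lam_br j) (e j) (by simp [S1.lam_e])
  have hl2' := E2.left_values S2 hl2 fun j => hnc (lam' j) (S2.lam_br j) (f j) (by simp [S2.lam_e])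
  obtain ⟨g, hg, σ, c, hc, hgc⟩ := S1.conj S2
  have S1' : IsSys br0 (fun j => e (σ j)) (fun j => lam (σ j)) (fun j => ρ1 (h (σ j))) := by
    refine ⟨?_, fun i => S1.lam_br _, ?_, fun i => S1.der _, ?_⟩
    · intro T hT hT'
      refine S1.gen T (fun i => ?_) hT'
      have : e (σ (σ.symm i)) ∈ T := hT (σ.symm i)
      rwa [Equiv.apply_symm_apply] at this
    · intro i j
      rw [S1.lam_e]
      simp
    · intro i j
      have := S1.D_e (σ i) (σ j)
      simpa using this
  obtain ⟨Ψ1, hΨ1⟩ := E1.split hk S1'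
  obtain ⟨Ψ2, hΨ2⟩ := E2.split hk S2
  refine glue E1 E2 S1'.gen g hg (fun j => h (σ j)) h' Ψ1 hΨ1 Ψ2 hΨ2 S1'.D_e ?_
    (fun i j => hh1 _ _) hh2 ?_ ?_
  · intro i j
    have := S2.D_e i j
    rw [hgc, map_smul, this]
    by_cases hij : i = j
    · simp [hij]
    · simp [hij]
  · intro i j
    have := hl1' (σ i) (σ j)
    simpa using this
  · intro i j
    have := hl2' i j
    simp only [hgc]
    constructor
    · rintro ⟨n, hn⟩
      rw [map_smul, map_smul, this.1 ⟨n, fun h0 => hn (by rw [map_smul, h0, smul_zero])⟩]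
      by_cases hij : i = j
      · simp [hij]
      · simp [hij]
    · intro hn
      rw [map_smul, map_smul, this.2, smul_zero]
      intro n
      have h3 := hn n
      rw [map_smul] at h3
      exact (smul_eq_zero.1 h3).resolve_left (hc j)

end Glue

/-- Theorem 3.12, uniqueness part. Let `N₀` be a nilpotent complex
Leibniz algebra which is a direct sum of non-split non-abelian ideals. Then any two
solvable Leibniz algebras with nilradical isomorphic to `N₀` and of dimension
`dim N₀ + dim (N₀/N₀²)` are isomorphic. -/
theorem stmt6 {N0 : Type u} {L1 : Type v} {L2 : Type w}
    [AddCommGroup N0] [Module ℂ N0] [FiniteDimensional ℂ N0]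
    [AddCommGroup L1] [Module ℂ L1] [FiniteDimensional ℂ L1]
    [AddCommGroup L2] [Module ℂ L2] [FiniteDimensional ℂ L2]
    (br0 : Bil N0) (h0 : IsLeibniz br0)
    (hnil : IsNilpotentSub br0 (⊤ : Submodule ℂ N0))
    (s : ℕ) (Ns : Fin s → Submodule ℂ N0)
    (hideal : ∀ t, IsIdeal br0 (Ns t))
    (hindep : iSupIndep Ns) (hsup : (⨆ t, Ns t) = (⊤ : Submodule ℂ N0))
    (hnonsplit : ∀ t, ¬ IsSplitIn br0 (Ns t))
    (hnonab : ∀ t, ¬ IsAbelianIn br0 (Ns t))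
    (br1 : Bil L1) (h1 : IsLeibniz br1) (hs1 : IsSolvableSub br1 (⊤ : Submodule ℂ L1))
    (br2 : Bil L2) (h2 : IsLeibniz br2) (hs2 : IsSolvableSub br2 (⊤ : Submodule ℂ L2))
    (N1 : Submodule ℂ L1) (hN1 : IsNilradical br1 N1)
    (N2 : Submodule ℂ L2) (hN2 : IsNilradical br2 N2)
    (hiso1 : SubAlgIso br0 ⊤ br1 N1) (hiso2 : SubAlgIso br0 ⊤ br2 N2)
    (hd1 : finrank ℂ L1 = finrank ℂ N0 + dimModSq br0 (⊤ : Submodule ℂ N0))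
    (hd2 : finrank ℂ L2 = finrank ℂ N0 + dimModSq br0 (⊤ : Submodule ℂ N0)) :
    AlgIso br1 br2 := by
  obtain ⟨φ1, ρ1, E1⟩ := exists_isExt br0 h0 hnil br1 h1 hs1 N1 hN1 hiso1 hd1
  obtain ⟨φ2, ρ2, E2⟩ := exists_isExt br0 h0 hnil br2 h2 hs2 N2 hN2 hiso2 hd2
  exact glue_final E1 E2
    (noncentral br0 s Ns hideal hindep hsup hnonsplit hnonab)
end

section
/- Let R be a finite-dimensional complex solvable Leibniz algebra with nilradical N, and let Q be a subspace with R = N ⊕ Q as vector spaces and dim Q = dim(N/N²). Then Ann_r(R) = I, where I is the two-sided ideal of R generated by the set {[x,x] : x ∈ R}. -/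
open Module Submodule

universe u v w

variable {L : Type u} [AddCommGroup L] [Module ℂ L]

lemma mem_bspan' (br : Bil L) {S T : Submodule ℂ L} {x y : L} (hx : x ∈ S) (hy : y ∈ T) :
    br x y ∈ bspan br S T := Submodule.subset_span ⟨x, hx, y, hy, rfl⟩

lemma bspan_le' (br : Bil L) {S T K : Submodule ℂ L}
    (h : ∀ x ∈ S, ∀ y ∈ T, br x y ∈ K) : bspan br S T ≤ K := by
  refine Submodule.span_le.2 ?_
  rintro z ⟨x, hx, y, hy, rfl⟩
  exact h x hx y hy

lemma lcs_le (br : Bil L) (N : Submodule ℂ L) (hN : ∀ x ∈ N, ∀ y ∈ N, br x y ∈ N) (n : ℕ) :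
    lcs br N n ≤ N := by
  induction n with
  | zero => exact le_refl _
  | succ n ih => exact bspan_le' br fun x hx y hy => hN x (ih hx) y hy

lemma lcs_stable (br : Bil L) (N : Submodule ℂ L) (D : L →ₗ[ℂ] L)
    (hD : ∀ u v, D (br u v) = br (D u) v + br u (D v))
    (hDN : ∀ x ∈ N, D x ∈ N) (n : ℕ) : ∀ x ∈ lcs br N n, D x ∈ lcs br N n := by
  induction n with
  | zero => exact hDN
  | succ n ih =>
    have : lcs br N (n+1) ≤ (lcs br N (n+1)).comap D := by
      refine bspan_le' br fun x hx y hy => ?_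
      rw [Submodule.mem_comap, hD]
      exact add_mem (mem_bspan' br (ih x hx) hy) (mem_bspan' br hx (hDN y hy))
    exact this

lemma pow_stable {V : Type*} [AddCommGroup V] [Module ℂ V] (K : Submodule ℂ V)
    (D : Module.End ℂ V) (h : ∀ x ∈ K, D x ∈ K) (a : ℂ) (m : ℕ) :
    ∀ x ∈ K, ((D - a • (1 : Module.End ℂ V)) ^ m) x ∈ K := by
  induction m with
  | zero => intro x hx; simpa using hx
  | succ m ih =>
    intro x hx
    rw [pow_succ, Module.End.mul_apply]
    apply ih
    simp only [LinearMap.sub_apply, LinearMap.smul_apply, Module.End.one_apply]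
    exact sub_mem (h x hx) (K.smul_mem _ hx)

lemma key_pow (br : Bil L) (hleib : IsLeibniz br) (N : Submodule ℂ L) (D : Module.End ℂ L)
    (hD : ∀ u v, D (br u v) = br (D u) v + br u (D v))
    (hDN : ∀ x ∈ N, D x ∈ N) (n : ℕ) (a c : ℂ) (s : ℕ) : ∀ p q : ℕ, p + q = s →
    ∀ u ∈ lcs br N n, ∀ v ∈ N,
      ((D - a • (1 : Module.End ℂ L)) ^ p) u ∈ lcs br N (n+1) →
      ((D - c • (1 : Module.End ℂ L)) ^ q) v ∈ bspan br N N →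
      ((D - (a + c) • (1 : Module.End ℂ L)) ^ (p + q)) (br u v) ∈ lcs br N (n+2) := by
  induction s with
  | zero =>
    intro p q hpq u hu v hv h1 h2
    obtain ⟨rfl, rfl⟩ : p = 0 ∧ q = 0 := by omega
    simp only [pow_zero, Module.End.one_apply] at h1
    exact mem_bspan' br h1 hv
  | succ s ih =>
    intro p q hpq u hu v hv h1 h2
    rcases p with _ | p
    · refine pow_stable _ D (lcs_stable br N D hD hDN (n+2)) _ _ _ ?_
      simp only [pow_zero, Module.End.one_apply] at h1
      exact mem_bspan' br h1 hv
    rcases q with _ | q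
    · refine pow_stable _ D (lcs_stable br N D hD hDN (n+2)) _ _ _ ?_
      simp only [pow_zero, Module.End.one_apply] at h2
      have : bspan br N N ≤ (lcs br N (n+2)).comap (br u) := by
        refine bspan_le' br fun x hx y hy => ?_
        rw [Submodule.mem_comap]
        have := hleib u x y
        rw [eq_comm, ← eq_sub_iff_add_eq'] at this
        rw [this]
        exact sub_mem (mem_bspan' br (mem_bspan' br hu hx) hy)
          (mem_bspan' br (mem_bspan' br hu hy) hx)
      exact this h2
    · have e : (D - (a + c) • (1 : Module.End ℂ L)) (br u v)
          = br ((D - a • (1 : Module.End ℂ L)) u) v + br u ((D - c • (1 : Module.End ℂ L)) v) := by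
        simp only [LinearMap.sub_apply, LinearMap.smul_apply, Module.End.one_apply, hD, map_sub,
          map_smul]
        rw [add_smul]
        abel
      have hu' : (D - a • (1 : Module.End ℂ L)) u ∈ lcs br N n := by
        simpa using pow_stable _ D (lcs_stable br N D hD hDN n) a 1 u hu
      have hv' : (D - c • (1 : Module.End ℂ L)) v ∈ N := by
        simpa using pow_stable _ D hDN c 1 v hv
      have e2 : p + 1 + (q + 1) = (p + q + 1) + 1 := by ring
      rw [e2, pow_succ, Module.End.mul_apply, e, map_add]
      refine add_mem ?_ ?_
      · have := ih p (q+1) (by omega) _ hu' v hv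
          (by rwa [pow_succ, Module.End.mul_apply] at h1) h2
        rwa [← add_assoc] at this
      · have := ih (p+1) q (by omega) u hu _ hv' h1
          (by rwa [pow_succ, Module.End.mul_apply] at h2)
        rwa [show p + 1 + q = p + q + 1 by ring] at this

lemma key_lcs (br : Bil L) (hleib : IsLeibniz br) (N : Submodule ℂ L) (D : Module.End ℂ L)
    (hD : ∀ u v, D (br u v) = br (D u) v + br u (D v))
    (hDN : ∀ x ∈ N, D x ∈ N) (c : ℂ) (m : ℕ)
    (hm : ∀ v ∈ N, ((D - c • (1 : Module.End ℂ L)) ^ m) v ∈ bspan br N N) (n : ℕ) :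
    ∃ p : ℕ, ∀ v ∈ lcs br N n,
      ((D - (((n : ℂ) + 1) * c) • (1 : Module.End ℂ L)) ^ p) v ∈ lcs br N (n+1) := by
  induction n with
  | zero => exact ⟨m, fun v hv => by
      rw [show (((0 : ℕ) : ℂ) + 1) * c = c by simp]; exact hm v hv⟩
  | succ n ih =>
    obtain ⟨p, hp⟩ := ih
    refine ⟨p + m, ?_⟩
    have e : (((n + 1 : ℕ) : ℂ) + 1) * c = ((n : ℂ) + 1) * c + c := by push_cast; ring
    rw [e]
    have : lcs br N (n+1) ≤ (lcs br N (n+2)).comap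
        ((D - (((n : ℂ) + 1) * c + c) • (1 : Module.End ℂ L)) ^ (p + m)) :=
      bspan_le' br fun u hu v hv => key_pow br hleib N D hD hDN n _ c (p + m) p m rfl u hu v hv
        (hp u hu) (hm v hv)
    exact this

lemma pow_eigen {V : Type*} [AddCommGroup V] [Module ℂ V] (D : Module.End ℂ V) (v : V) (a : ℂ)
    (h : D v = a • v) (m : ℕ) : (D ^ m) v = a ^ m • v := by
  induction m with
  | zero => simp
  | succ m ih => rw [pow_succ, Module.End.mul_apply, h, map_smul, ih, smul_smul, pow_succ, mul_comm]

/-- If `D - 1` is nilpotent on `N/N²`, then `D` is injective on `N`. -/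
lemma inj_of_unip (br : Bil L) (hleib : IsLeibniz br) (N : Submodule ℂ L)
    (hnil : IsNilpotentSub br N) (D : Module.End ℂ L)
    (hD : ∀ u v, D (br u v) = br (D u) v + br u (D v))
    (hDN : ∀ x ∈ N, D x ∈ N) (m : ℕ)
    (hm : ∀ v ∈ N, ((D - (1 : ℂ) • (1 : Module.End ℂ L)) ^ m) v ∈ bspan br N N)
    (a : L) (ha : a ∈ N) (h0 : D a = 0) : a = 0 := by
  have h : ∀ n, a ∈ lcs br N n := by
    intro n
    induction n with
    | zero => exact ha
    | succ n ih =>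
      obtain ⟨p, hp⟩ := key_lcs br hleib N D hD hDN 1 m hm n
      have h1 := hp a ih
      rw [pow_eigen _ a (-((n : ℂ) + 1)) (by
        simp only [LinearMap.sub_apply, LinearMap.smul_apply, Module.End.one_apply, h0, mul_one,
          zero_sub, neg_smul])] at h1
      have hne : (-((n : ℂ) + 1)) ^ p ≠ 0 := pow_ne_zero _ (neg_ne_zero.2 (by exact_mod_cast n.succ_ne_zero))
      exact (Submodule.smul_mem_iff _ hne).1 h1
  obtain ⟨n, hn⟩ := hnil
  have := h n
  rw [hn] at this
  simpa using this

/-- If `D` is nilpotent on `N/N²`, then `D` is nilpotent on `N`. -/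
lemma nil_of_nil (br : Bil L) (hleib : IsLeibniz br) (N : Submodule ℂ L)
    (hnil : IsNilpotentSub br N) (D : Module.End ℂ L)
    (hD : ∀ u v, D (br u v) = br (D u) v + br u (D v))
    (hDN : ∀ x ∈ N, D x ∈ N) (m : ℕ)
    (hm : ∀ v ∈ N, (D ^ m) v ∈ bspan br N N) : ∃ p : ℕ, ∀ v ∈ N, (D ^ p) v = 0 := by
  have h : ∀ n, ∃ p : ℕ, ∀ v ∈ N, (D ^ p) v ∈ lcs br N n := by
    intro n
    induction n with
    | zero => exact ⟨0, fun v hv => by simpa [lcs] using hv⟩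
    | succ n ih =>
      obtain ⟨q, hq⟩ := ih
      obtain ⟨p, hp⟩ := key_lcs br hleib N D hD hDN 0 m (by simpa using hm) n
      refine ⟨p + q, fun v hv => ?_⟩
      have := hp _ (hq v hv)
      simpa [pow_add, Module.End.mul_apply] using this
  obtain ⟨n, hn⟩ := hnil
  obtain ⟨p, hp⟩ := h n
  refine ⟨p, fun v hv => ?_⟩
  have := hp v hv
  rw [hn] at this
  simpa using this

/-- Lie's theorem: flags. -/
lemma lie_flag {S : Type*} [LieRing S] [LieAlgebra ℂ S] [LieAlgebra.IsSolvable S] (n : ℕ) :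
    ∀ (V : Type u) [AddCommGroup V] [Module ℂ V] [LieRingModule S V] [LieModule ℂ S V]
      [FiniteDimensional ℂ V], finrank ℂ V = n →
    ∃ (F : ℕ → LieSubmodule ℂ S V) (χ : ℕ → Module.Dual ℂ S), F 0 = ⊤ ∧ F n = ⊥ ∧
      (∀ i < n, ∃ v ∈ F i, v ∉ F (i+1)) ∧ (∀ i < n, F (i+1) ≤ F i) ∧
      (∀ i < n, ∀ s t : S, χ i ⁅s, t⁆ = 0) ∧
      (∀ i < n, ∀ s : S, ∀ v ∈ F i, ⁅s, v⁆ - χ i s • v ∈ F (i+1)) := by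
  induction n with
  | zero =>
    intro V _ _ _ _ _ h
    have : Subsingleton V := Module.finrank_zero_iff.1 h
    refine ⟨fun _ => ⊥, fun _ => 0, Subsingleton.elim _ _, rfl, ?_, ?_, ?_, ?_⟩ <;> simp
  | succ n ih =>
    intro V _ _ _ _ _ h
    have : Nontrivial V := Module.nontrivial_of_finrank_pos (R := ℂ) (by omega)
    obtain ⟨χ0, hχ⟩ := LieModule.exists_nontrivial_weightSpace_of_isSolvable ℂ S V
    obtain ⟨⟨v, hv⟩, hv0⟩ := exists_ne (0 : LieModule.weightSpace V χ0)
    have hv0 : v ≠ 0 := fun h => hv0 (Subtype.ext h)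
    rw [LieModule.mem_weightSpace] at hv
    let P : LieSubmodule ℂ S V :=
      { (ℂ ∙ v) with
        lie_mem := by
          intro s w hw
          obtain ⟨c, rfl⟩ := Submodule.mem_span_singleton.1 hw
          rw [lie_smul, hv]
          exact Submodule.smul_mem _ _ (Submodule.smul_mem _ _ (Submodule.mem_span_singleton_self v)) }
    have hP : ∀ w, w ∈ P ↔ ∃ c : ℂ, c • v = w := fun w => Submodule.mem_span_singleton
    have hPr : finrank ℂ (V ⧸ P) = n := by
      have h1 := Submodule.finrank_quotient_add_finrank (ℂ ∙ v)
      rw [finrank_span_singleton hv0] at h1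
      have : finrank ℂ (V ⧸ P) = finrank ℂ (V ⧸ (ℂ ∙ v)) := rfl
      omega
    obtain ⟨F, χ, hF0, hFn, h1, h2, h3, h4⟩ := ih (V ⧸ P) hPr
    have hmem : ∀ i w, w ∈ (F i).comap (LieSubmodule.Quotient.mk' P) ↔
      LieSubmodule.Quotient.mk' P w ∈ F i := fun i w => Iff.rfl
    have hker : ∀ w, LieSubmodule.Quotient.mk' P w = 0 ↔ w ∈ P := fun w => by
      simp
    refine ⟨fun i => if i ≤ n then (F i).comap (LieSubmodule.Quotient.mk' P) else ⊥,
      fun i => if i < n then χ i else χ0, ?_, ?_, ?_, ?_, ?_, ?_⟩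
    · ext w; simp [hF0]
    · simp
    · intro i hi
      rcases Nat.lt_succ_iff_lt_or_eq.1 hi with hi | rfl
      · obtain ⟨w, hw, hw'⟩ := h1 i hi
        obtain ⟨w, rfl⟩ := LieSubmodule.Quotient.surjective_mk' P w
        refine ⟨w, ?_, ?_⟩
        · dsimp only; rw [if_pos hi.le]; exact hw
        · dsimp only; rw [if_pos (by omega)]; exact hw'
      · refine ⟨v, ?_, ?_⟩
        · dsimp only
          rw [if_pos le_rfl, hmem, hFn, LieSubmodule.mem_bot, hker, hP]
          exact ⟨1, one_smul _ _⟩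
        · dsimp only; rw [if_neg (by omega)]; simpa using hv0
    · intro i hi
      rcases Nat.lt_succ_iff_lt_or_eq.1 hi with hi | rfl
      · dsimp only
        rw [if_pos hi.le, if_pos (by omega)]
        intro w hw
        exact h2 i hi hw
      · dsimp only
        rw [if_neg (by omega : ¬ (i + 1 ≤ i))]; exact bot_le
    · intro i hi s t
      rcases Nat.lt_succ_iff_lt_or_eq.1 hi with hi | rfl
      · dsimp only; rw [if_pos hi]; exact h3 i hi s t
      · dsimp only; rw [if_neg (lt_irrefl _)]
        have e := hv ⁅s, t⁆
        rw [lie_lie, hv s, hv t, lie_smul, lie_smul, hv s, hv t, smul_comm, sub_self] at e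
        exact (smul_eq_zero.1 e.symm).resolve_right hv0
    · intro i hi s w hw
      rcases Nat.lt_succ_iff_lt_or_eq.1 hi with hi | rfl
      · dsimp only at hw ⊢
        rw [if_pos hi.le] at hw
        rw [if_pos hi, if_pos (by omega), hmem, map_sub, map_smul, LieModuleHom.map_lie]
        exact h4 i hi s _ hw
      · dsimp only at hw ⊢
        rw [if_pos le_rfl, hmem, hFn, LieSubmodule.mem_bot, hker, hP] at hw
        obtain ⟨c, rfl⟩ := hw
        rw [if_neg (lt_irrefl _), if_neg (by omega), LieSubmodule.mem_bot, lie_smul, hv,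
          smul_comm, sub_self]


attribute [local instance] LieRing.ofAssociativeRing

/-- The Lie algebra of right multiplications. -/
def rightMul (br : Bil L) (hleib : IsLeibniz br) : LieSubalgebra ℂ (Module.End ℂ L) :=
  { LinearMap.range br.flip with
    lie_mem' := by
      rintro _ _ ⟨z, rfl⟩ ⟨y, rfl⟩
      refine ⟨br y z, ?_⟩
      ext x
      have := hleib x y z
      rw [LieRing.of_associative_ring_bracket]
      simp only [LinearMap.flip_apply, LinearMap.sub_apply, Module.End.mul_apply]
      rw [this]; abel }

/-- The right multiplication map. -/
def rmap (br : Bil L) (hleib : IsLeibniz br) : L →ₗ[ℂ] rightMul br hleib :=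
  LinearMap.codRestrict (rightMul br hleib).toSubmodule br.flip (fun x => ⟨x, rfl⟩)

lemma rmap_surj (br : Bil L) (hleib : IsLeibniz br) (s : rightMul br hleib) :
    ∃ x, rmap br hleib x = s := by
  obtain ⟨_, x, rfl⟩ := s
  exact ⟨x, rfl⟩

lemma rmap_lie (br : Bil L) (hleib : IsLeibniz br) (x v : L) :
    ⁅rmap br hleib x, v⁆ = br v x := rfl

lemma rmap_bracket (br : Bil L) (hleib : IsLeibniz br) (y z : L) :
    ⁅rmap br hleib z, rmap br hleib y⁆ = rmap br hleib (br y z) := by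
  apply Subtype.ext
  ext x
  have := hleib x y z
  change br (br x y) z - br (br x z) y = br x (br y z)
  rw [this]; abel

lemma rightMul_solvable (br : Bil L) (hleib : IsLeibniz br)
    (hsolv : IsSolvableSub br (⊤ : Submodule ℂ L)) :
    LieAlgebra.IsSolvable (rightMul br hleib) := by
  have h : ∀ k, (LieAlgebra.derivedSeries ℂ (rightMul br hleib) k).toSubmodule ≤
      (derS br ⊤ k).map (rmap br hleib) := by
    intro k
    induction k with
    | zero =>
      intro s _
      obtain ⟨x, rfl⟩ := rmap_surj br hleib s
      exact ⟨x, trivial, rfl⟩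
    | succ k ih =>
      rw [LieAlgebra.derivedSeries_def, LieAlgebra.derivedSeriesOfIdeal_succ,
        LieSubmodule.lieIdeal_oper_eq_linear_span', Submodule.span_le]
      rintro _ ⟨s, hs, t, ht, rfl⟩
      obtain ⟨x, hx, rfl⟩ := ih hs
      obtain ⟨y, hy, rfl⟩ := ih ht
      exact ⟨br y x, mem_bspan' br hy hx, (rmap_bracket br hleib y x).symm⟩
  obtain ⟨m, hm⟩ := hsolv
  refine LieAlgebra.IsSolvable.mk (R := ℂ) (k := m) ?_
  rw [← LieSubmodule.toSubmodule_eq_bot, eq_bot_iff]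
  simpa [hm] using h m

/-- The space of elements on which the characters of a flag vanish is inside the nilradical. -/
lemma mem_N_of_nilp [FiniteDimensional ℂ L] (br : Bil L) (hleib : IsLeibniz br)
    (hsolv : IsSolvableSub br (⊤ : Submodule ℂ L)) (N : Submodule ℂ L) (hN : IsNilradical br N) :
    (∀ x y, br x y ∈ N) ∧ (∀ x, (∃ m : ℕ, ∀ v, ((br.flip x : Module.End ℂ L) ^ m) v = 0) → x ∈ N) := by
  have := rightMul_solvable br hleib hsolv
  obtain ⟨F, χ, hF0, hFn, h1, -, h3, h4⟩ :=
    lie_flag (S := rightMul br hleib) (finrank ℂ L) L rfl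
  let T : Submodule ℂ L := ⨅ i : Fin (finrank ℂ L), LinearMap.ker ((χ i) ∘ₗ rmap br hleib)
  have hT : ∀ x, x ∈ T ↔ ∀ i < finrank ℂ L, χ i (rmap br hleib x) = 0 := by
    intro x
    simp only [T, Submodule.mem_iInf, LinearMap.mem_ker, LinearMap.comp_apply]
    exact ⟨fun h i hi => h ⟨i, hi⟩, fun h i => h i i.2⟩
  have hsq : ∀ x y, br x y ∈ T := by
    intro x y
    rw [hT]
    intro i hi
    rw [← rmap_bracket]
    exact h3 i hi _ _
  have hTN : T ≤ N := by
    refine hN.2.2 T ⟨le_top, fun x _ y _ => ⟨hsq _ _, hsq _ _⟩⟩ ⟨finrank ℂ L, ?_⟩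
    have : ∀ n ≤ finrank ℂ L, lcs br T n ≤ (F n).toSubmodule := by
      intro n
      induction n with
      | zero => intro _; rw [hF0]; exact le_top
      | succ n ih =>
        intro hn
        refine bspan_le' br fun u hu t ht => ?_
        have e := h4 n hn (rmap br hleib t) u (ih (by omega) hu)
        rw [(hT t).1 ht n hn, zero_smul, sub_zero, rmap_lie] at e
        exact e
    have := this _ le_rfl
    rw [hFn] at this
    exact eq_bot_iff.2 this
  refine ⟨fun x y => hTN (hsq x y), fun x ⟨m, hm⟩ => hTN ((hT x).2 fun i hi => ?_)⟩
  obtain ⟨v, hv, hv'⟩ := h1 i hi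
  by_contra hne
  have hst : ∀ (k : ℕ), ∀ w ∈ F (i+1), ((br.flip x : Module.End ℂ L) ^ k) w ∈ F (i+1) := by
    intro k w hw
    have := pow_stable (F (i+1)).toSubmodule (br.flip x)
      (fun w hw => LieSubmodule.lie_mem (F (i+1)) (x := rmap br hleib x) hw) 0 k w hw
    rwa [zero_smul, sub_zero] at this
  have hp : ∀ k : ℕ, ((br.flip x : Module.End ℂ L) ^ k) v - (χ i (rmap br hleib x)) ^ k • v
      ∈ F (i+1) := by
    intro k
    induction k with
    | zero => simp
    | succ k ih =>
      have e := hst k _ (h4 i hi (rmap br hleib x) v hv)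
      rw [map_sub, map_smul] at e
      have e2 := add_mem e ((F (i+1)).smul_mem (χ i (rmap br hleib x)) ih)
      rw [smul_sub, smul_smul, ← pow_succ', sub_add_sub_cancel] at e2
      rw [pow_succ, Module.End.mul_apply]
      exact e2
  have e := hp m
  rw [hm, zero_sub, ← neg_smul] at e
  exact hv' (((F (i+1)).toSubmodule.smul_mem_iff (neg_ne_zero.2 (pow_ne_zero m hne))).1 e)

/-- Characters on `N/N²`. -/
lemma chars_quot [FiniteDimensional ℂ L] (br : Bil L) (hleib : IsLeibniz br)
    (hsolv : IsSolvableSub br (⊤ : Submodule ℂ L)) (N : Submodule ℂ L) (hN : IsIdeal br N) :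
    ∃ β : ℕ → Module.Dual ℂ L, ∀ (x : L) (c : ℂ), (∀ i < dimModSq br N, β i x = c) →
      ∀ v ∈ N, (((br.flip x : Module.End ℂ L) - c • (1 : Module.End ℂ L)) ^ (dimModSq br N)) v
        ∈ bspan br N N := by
  have := rightMul_solvable br hleib hsolv
  have hNst : ∀ x, ∀ v ∈ N, br v x ∈ N := fun x v hv => (hN.2 v hv x trivial).1
  let N' : LieSubmodule ℂ (rightMul br hleib) L :=
    { N with
      lie_mem := by
        intro s v hv
        obtain ⟨x, rfl⟩ := rmap_surj br hleib s
        exact hNst x v hv }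
  let M : LieSubmodule ℂ (rightMul br hleib) N' :=
    { Submodule.comap N.subtype (sqr br N) with
      lie_mem := by
        intro s v hv
        obtain ⟨x, rfl⟩ := rmap_surj br hleib s
        exact lcs_stable br N (br.flip x) (fun u v => hleib u v x) (hNst x) 1 _ hv }
  obtain ⟨F, χ, hF0, hFn, -, -, -, h4⟩ :=
    lie_flag (S := rightMul br hleib) (dimModSq br N) (N' ⧸ M) rfl
  refine ⟨fun i => χ i ∘ₗ rmap br hleib, fun x c hc v hv => ?_⟩
  have key : ∀ n ≤ dimModSq br N, ∃ hm : (((br.flip x : Module.End ℂ L) -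
      c • (1 : Module.End ℂ L)) ^ n) v ∈ N', LieSubmodule.Quotient.mk' M ⟨_, hm⟩ ∈ F n := by
    intro n
    induction n with
    | zero => intro _; exact ⟨hv, by rw [hF0]; trivial⟩
    | succ n ih =>
      intro hn
      obtain ⟨hm, hF⟩ := ih (by omega)
      refine ⟨pow_stable N (br.flip x) (hNst x) c _ v hv, ?_⟩
      have e := h4 n hn (rmap br hleib x) _ hF
      have hcn : χ n (rmap br hleib x) = c := hc n hn
      rw [hcn, ← LieModuleHom.map_lie, ← map_smul, ← map_sub] at e
      convert e using 2
      apply Subtype.ext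
      exact (congrArg (fun g : Module.End ℂ L => g v)
        (pow_succ' ((br.flip x : Module.End ℂ L) - c • (1 : Module.End ℂ L)) n)).trans rfl
  obtain ⟨hm, hF⟩ := key _ le_rfl
  rw [hFn, LieSubmodule.mem_bot, LieSubmodule.Quotient.mk_eq_zero] at hF
  exact hF

lemma exists_inj [FiniteDimensional ℂ L] (br : Bil L) (hleib : IsLeibniz br)
    (hsolv : IsSolvableSub br (⊤ : Submodule ℂ L))
    (N Q : Submodule ℂ L) (hN : IsNilradical br N) (hQ : IsCompl N Q)
    (hdimQ : finrank ℂ Q = dimModSq br N) :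
    ∃ x, ∀ a ∈ N, br a x = 0 → a = 0 := by
  obtain ⟨hsq, hnilp⟩ := mem_N_of_nilp br hleib hsolv N hN
  obtain ⟨β, hβ⟩ := chars_quot br hleib hsolv N hN.1
  have hNst : ∀ x, ∀ v ∈ N, br.flip x v ∈ N := fun x v hv => (hN.1.2 v hv x trivial).1
  let Φ : Q →ₗ[ℂ] (Fin (dimModSq br N) → ℂ) := LinearMap.pi fun i => β i ∘ₗ Q.subtype
  have hinj : Function.Injective Φ := by
    rw [← LinearMap.ker_eq_bot, eq_bot_iff]
    rintro ⟨x, hx⟩ h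
    have h0 : ∀ i < dimModSq br N, β i x = 0 := fun i hi => congrFun h ⟨i, hi⟩
    have h1 := hβ x 0 h0
    rw [zero_smul, sub_zero] at h1
    obtain ⟨p, hp⟩ := nil_of_nil br hleib N hN.2.1 (br.flip x) (fun u v => hleib u v x)
      (hNst x) _ h1
    have hxN : x ∈ N := hnilp x ⟨p + 1, fun v => by
      rw [pow_succ, Module.End.mul_apply]; exact hp _ (hsq _ _)⟩
    have := Submodule.disjoint_def.1 hQ.disjoint x hxN hx
    rw [Submodule.mem_bot]
    exact Subtype.ext this
  have hsurj : Function.Surjective Φ :=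
    (LinearMap.injective_iff_surjective_of_finrank_eq_finrank (by simp [hdimQ])).1 hinj
  obtain ⟨x, hx⟩ := hsurj fun _ => 1
  have h1 : ∀ i < dimModSq br N, β i x = 1 := fun i hi => congrFun hx ⟨i, hi⟩
  exact ⟨x, fun a ha h0 => inj_of_unip br hleib N hN.2.1 (br.flip x) (fun u v => hleib u v x)
      (hNst x) _ (hβ x 1 h1) a ha h0⟩

/-- Proposition 6.2. For a solvable Leibniz algebra `R = N ⊕ Q` with
nilradical `N` and `dim Q = dim (N/N²)`, the right annihilator coincides with the
two-sided ideal generated by the squares `[x, x]`. -/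
theorem stmt10 {L : Type u} [AddCommGroup L] [Module ℂ L] [FiniteDimensional ℂ L]
    (br : Bil L) (hleib : IsLeibniz br) (hsolv : IsSolvableSub br (⊤ : Submodule ℂ L))
    (N Q : Submodule ℂ L) (hN : IsNilradical br N) (hQ : IsCompl N Q)
    (hdimQ : finrank ℂ Q = dimModSq br N) :
    {a : L | ∀ y : L, br y a = 0} =
      (sInf {J : Submodule ℂ L | IsIdeal br J ∧ ∀ x : L, br x x ∈ J} : Submodule ℂ L) := by
  obtain ⟨x, hx⟩ := exists_inj br hleib hsolv N Q hN hQ hdimQ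
  let A : Submodule ℂ L := LinearMap.ker br.flip
  have hA : ∀ a, a ∈ A ↔ ∀ y, br y a = 0 := fun a => by
    simp only [A, LinearMap.mem_ker, LinearMap.ext_iff, LinearMap.flip_apply, LinearMap.zero_apply]
  have hAsq : ∀ z, br z z ∈ A := fun z => by
    rw [hA]; intro y
    have := hleib y z z
    simpa using this
  have hAid : IsIdeal br A := by
    refine ⟨le_top, fun a ha y _ => ⟨?_, ?_⟩⟩
    · rw [hA] at ha ⊢
      intro z
      have := hleib z a y
      rw [ha, ha, map_zero, LinearMap.zero_apply, zero_add] at this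
      exact this.symm
    · rw [(hA a).1 ha]; exact zero_mem _
  have hAN : A ≤ N := by
    refine hN.2.2 A hAid ⟨1, eq_bot_iff.2 (bspan_le' br fun u _ v hv => ?_)⟩
    rw [(hA v).1 hv]; exact zero_mem _
  apply Set.Subset.antisymm
  · intro a ha
    have haA : a ∈ A := (hA a).2 ha
    rw [SetLike.mem_coe, Submodule.mem_sInf]
    rintro J ⟨hJ, hJsq⟩
    -- pass to an ideal inside `N`
    let K : Submodule ℂ L := J ⊓ A
    have hKst : ∀ v ∈ K, br.flip x v ∈ K := fun v hv =>
      ⟨(hJ.2 v hv.1 x trivial).1, (hAid.2 v hv.2 x trivial).1⟩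
    have hax : br a x ∈ K := by
      refine ⟨?_, (hAid.2 a haA x trivial).1⟩
      have e := sub_mem (sub_mem (hJsq (a + x)) (hJsq a)) (hJsq x)
      have e2 : br (a + x) (a + x) - br a a - br x x = br a x := by
        simp only [map_add, LinearMap.add_apply]
        rw [ha x]; abel
      rwa [e2] at e
    let f : K →ₗ[ℂ] K := (br.flip x).restrict hKst
    have hf : Function.Injective f := by
      rw [← LinearMap.ker_eq_bot, eq_bot_iff]
      rintro ⟨v, hv⟩ h
      rw [Submodule.mem_bot]
      exact Subtype.ext (hx v (hAN hv.2) (congrArg Subtype.val h))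
    obtain ⟨⟨b, hb⟩, hfb⟩ := (LinearMap.injective_iff_surjective.1 hf) ⟨br a x, hax⟩
    have e : br b x = br a x := congrArg Subtype.val hfb
    have : a - b = 0 := hx _ (sub_mem (hAN haA) (hAN hb.2)) (by
      rw [map_sub, LinearMap.sub_apply, e, sub_self])
    rw [sub_eq_zero.1 this]
    exact hb.1
  · intro a ha
    rw [SetLike.mem_coe, Submodule.mem_sInf] at ha
    exact (hA a).1 (ha A ⟨hAid, hAsq⟩)
end
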